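/- Suppose a < 0, b > 0 and 2b + a = 0, and for each t ≥ 0 let c_t := lim_{Δ→∞} Δ^{1 + b/a} · Cov(X(t), X(t+Δ)) (this limit exists in ℝ for each t). Then lim_{t→∞} c_t / ( t^{−1/2} log t ) = σ² / (4 a²), which is strictly positive. -/

import Mathlib

open MeasureTheory ProbabilityTheory Filter Real Set

noncomputable section

/-- `B` is a standard one-dimensional Brownian motion adapted to the filtration `F`
under the probability measure `P`: all paths are continuous and start at `0`, the
increment `B t - B s` is Gaussian with mean `0` and variance `t - s`, and increments
after time `s` are independent of `F s`. -/
def IsStdBrownian {Ω : Type*} {mΩ : MeasurableSpace Ω} (P : Measure Ω)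
    (F : MeasureTheory.Filtration ℝ mΩ) (B : ℝ → Ω → ℝ) : Prop :=
  MeasureTheory.Adapted F B ∧
  (∀ ω, B 0 ω = 0) ∧
  (∀ ω, Continuous fun t => B t ω) ∧
  (∀ s t : ℝ, 0 ≤ s → s ≤ t →
    P.map (fun ω => B t ω - B s ω) = gaussianReal 0 (Real.toNNReal (t - s))) ∧
  (∀ s t : ℝ, 0 ≤ s → s ≤ t →
    Indep (MeasurableSpace.comap (fun ω => B t ω - B s ω) Real.measurableSpace) (F s) P)

/-- `X` is the (continuous, adapted) solution of the affine stochastic functional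
differential equation `dX(t) = (a X(t) + b/(1+t) ∫_{-1}^t X(s) ds) dt + σ dB(t)` for
`t ≥ 0`, with initial history `ψ` on `[-1, 0]`; i.e. almost surely, for all `t ≥ 0`,
`X t = ψ 0 + ∫_0^t (a X(s) + b/(1+s) (∫_{-1}^0 ψ(u) du + ∫_0^s X(u) du)) ds + σ B t`. -/
def IsSolutionSFDE {Ω : Type*} {mΩ : MeasurableSpace Ω} (P : Measure Ω)
    (F : MeasureTheory.Filtration ℝ mΩ) (a b σ : ℝ) (ψ : ℝ → ℝ)
    (B X : ℝ → Ω → ℝ) : Prop :=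
  (∀ t : ℝ, 0 ≤ t → StronglyMeasurable[F t] (X t)) ∧
  (∀ ω, ContinuousOn (fun t => X t ω) (Set.Ici (0 : ℝ))) ∧
  (∀ᵐ ω ∂P, ∀ t : ℝ, 0 ≤ t →
    X t ω = ψ 0
      + (∫ s in (0:ℝ)..t,
          (a * X s ω + b / (1 + s) * ((∫ u in (-1:ℝ)..(0:ℝ), ψ u) + ∫ u in (0:ℝ)..s, X u ω)))
      + σ * B t ω)

/-- The covariance `Cov(Y, Z) = E[Y Z] - E[Y] E[Z]` of two real random variables. -/
def rcov {Ω : Type*} {mΩ : MeasurableSpace Ω} (P : Measure Ω) (Y Z : Ω → ℝ) : ℝ :=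
  (∫ ω, Y ω * Z ω ∂P) - (∫ ω, Y ω ∂P) * (∫ ω, Z ω ∂P)

/-- The integrand of the Laplace transform of `x ↦ x ^ p * (x + α) ^ (-3/2)`. -/
def laplaceIntegrand (α p τ x : ℝ) : ℝ := rexp (-τ * x) * (x ^ p * (x + α) ^ (-(3:ℝ)/2))

/-- The Laplace transform of `x ↦ x ^ p * (x + α) ^ (-3/2)` on the half line. -/
def laplacePow (α p τ : ℝ) : ℝ := ∫ x in Ioi (0:ℝ), laplaceIntegrand α p τ x

lemma add_rpow_le {α x : ℝ} (hα : 0 < α) (hx : 0 ≤ x) :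
    (x + α) ^ (-(3:ℝ)/2) ≤ α ^ (-(3:ℝ)/2) :=
  Real.rpow_le_rpow_of_nonpos hα (by linarith) (by norm_num)

lemma laplaceIntegrand_pos {α p τ x : ℝ} (hα : 0 < α) (hx : 0 < x) :
    0 < laplaceIntegrand α p τ x := by
  unfold laplaceIntegrand; positivity

lemma laplaceIntegrand_le {α p τ x : ℝ} (hα : 0 < α) (hx : 0 < x) :
    laplaceIntegrand α p τ x ≤ x ^ p * rexp (-τ * x) * α ^ (-(3:ℝ)/2) := by
  unfold laplaceIntegrand
  have h := add_rpow_le hα hx.le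
  have h0 : 0 ≤ rexp (-τ * x) * x ^ p := by positivity
  nlinarith [mul_le_mul_of_nonneg_left h h0]

lemma measurable_laplaceIntegrand (α p τ : ℝ) : Measurable (laplaceIntegrand α p τ) := by
  unfold laplaceIntegrand; fun_prop

lemma integrableOn_rpow_mul_exp {p τ : ℝ} (hp : -1 < p) (hτ : 0 < τ) :
    IntegrableOn (fun x : ℝ => x ^ p * rexp (-τ * x)) (Ioi 0) := by
  simpa using integrableOn_rpow_mul_exp_neg_mul_rpow hp one_pos hτ

lemma integrableOn_laplaceIntegrand {α p τ : ℝ} (hα : 0 < α) (hp : -1 < p) (hτ : 0 < τ) :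
    IntegrableOn (laplaceIntegrand α p τ) (Ioi 0) := by
  refine Integrable.mono' ((integrableOn_rpow_mul_exp hp hτ).mul_const (α ^ (-(3:ℝ)/2)))
    (measurable_laplaceIntegrand α p τ).aestronglyMeasurable ?_
  filter_upwards [ae_restrict_mem measurableSet_Ioi] with x hx
  rw [Real.norm_of_nonneg (laplaceIntegrand_pos hα hx).le]
  exact laplaceIntegrand_le hα hx

lemma laplacePow_pos {α p τ : ℝ} (hα : 0 < α) (hp : -1 < p) (hτ : 0 < τ) :
    0 < laplacePow α p τ := by
  refine (integral_pos_iff_support_of_nonneg_ae ?_ (integrableOn_laplaceIntegrand hα hp hτ)).2 ?_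
  · filter_upwards [ae_restrict_mem measurableSet_Ioi] with x hx
    exact (laplaceIntegrand_pos hα hx).le
  · rw [Measure.restrict_apply' measurableSet_Ioi]
    have : Function.support (laplaceIntegrand α p τ) ∩ Ioi 0 = Ioi 0 :=
      inter_eq_right.2 fun x hx => (laplaceIntegrand_pos hα hx).ne'
    simp [this]

lemma hasDerivAt_laplacePow {α p τ : ℝ} (hα : 0 < α) (hp : -1 < p) (hτ : 0 < τ) :
    HasDerivAt (laplacePow α p) (-laplacePow α (p + 1) τ) τ := by
  have key := (hasDerivAt_integral_of_dominated_loc_of_deriv_le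
    (μ := volume.restrict (Ioi (0:ℝ))) (F := laplaceIntegrand α p)
    (F' := fun τ x => -laplaceIntegrand α (p + 1) τ x) (x₀ := τ)
    (bound := fun x => laplaceIntegrand α (p + 1) (τ / 2) x)
    (Ioi_mem_nhds (show τ / 2 < τ by linarith))
    (Eventually.of_forall fun t => (measurable_laplaceIntegrand α p t).aestronglyMeasurable)
    (integrableOn_laplaceIntegrand hα hp hτ)
    (measurable_laplaceIntegrand α (p + 1) τ).neg.aestronglyMeasurable ?_
    (integrableOn_laplaceIntegrand hα (by linarith) (by linarith)) ?_).2
  · rw [integral_neg] at key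
    exact key
  · filter_upwards [ae_restrict_mem measurableSet_Ioi] with x hx t ht
    rw [norm_neg, Real.norm_of_nonneg (laplaceIntegrand_pos hα hx).le]
    have hx' : (0:ℝ) < x := hx
    have ht' : τ / 2 < t := ht
    unfold laplaceIntegrand
    gcongr
  · filter_upwards [ae_restrict_mem measurableSet_Ioi] with x hx t ht
    have hx' : (0:ℝ) < x := hx
    have h1 : HasDerivAt (fun t : ℝ => -t * x) (-1 * x) t := (hasDerivAt_id t).neg.mul_const x
    refine (h1.exp.mul_const (x ^ p * (x + α) ^ (-(3:ℝ)/2))).congr_deriv ?_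
    simp only [laplaceIntegrand]
    rw [Real.rpow_add_one hx'.ne']
    ring

lemma laplacePow_ode {α τ : ℝ} (hα : 0 < α) (hτ : 0 < τ) :
    laplacePow α (3/2) τ = -α * laplacePow α (1/2) τ + α / 2 / τ * laplacePow α (-1/2) τ := by
  have i1 := integrableOn_laplaceIntegrand (p := 3/2) hα (by norm_num) hτ
  have i2 := integrableOn_laplaceIntegrand (p := 1/2) hα (by norm_num) hτ
  have i3 := integrableOn_laplaceIntegrand (p := -1/2) hα (by norm_num) hτ
  have hd : ∀ x ∈ Ioi (0:ℝ), HasDerivAt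
      (fun x : ℝ => rexp (-τ * x) * (x ^ (1/2:ℝ) * (x + α) ^ (-(1:ℝ)/2)))
      (α / 2 * laplaceIntegrand α (-1/2) τ x - τ * (laplaceIntegrand α (3/2) τ x
        + α * laplaceIntegrand α (1/2) τ x)) x := by
    intro x hx
    have hx' : (0:ℝ) < x := hx
    have hxa : 0 < x + α := by linarith
    have h1 : HasDerivAt (fun x : ℝ => -τ * x) (-τ * 1) x := (hasDerivAt_id x).const_mul (-τ)
    have h2 := Real.hasDerivAt_rpow_const (x := x) (p := (1/2:ℝ)) (Or.inl hx'.ne')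
    have h3 : HasDerivAt (fun x : ℝ => (x + α) ^ (-(1:ℝ)/2))
        (1 * (-(1:ℝ)/2) * (x + α) ^ (-(1:ℝ)/2 - 1)) x :=
      ((hasDerivAt_id x).add_const α).rpow_const (Or.inl hxa.ne')
    refine (h1.exp.mul (h2.mul h3)).congr_deriv ?_
    simp only [laplaceIntegrand, Pi.mul_apply]
    have e1 : x ^ ((1:ℝ)/2) = x ^ (-(1:ℝ)/2) * x := by
      rw [← Real.rpow_add_one hx'.ne']; norm_num
    have e2 : x ^ ((3:ℝ)/2) = x ^ (-(1:ℝ)/2) * x * x := by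
      rw [← e1, ← Real.rpow_add_one hx'.ne']; norm_num
    have e3 : (x + α) ^ (-(1:ℝ)/2) = (x + α) ^ (-(3:ℝ)/2) * (x + α) := by
      rw [← Real.rpow_add_one hxa.ne']; norm_num
    have e4 : (1/2:ℝ) - 1 = -(1:ℝ)/2 := by norm_num
    have e5 : -(1:ℝ)/2 - 1 = -(3:ℝ)/2 := by norm_num
    rw [e4, e5, e1, e2, e3]
    ring
  have hintg := ((i3.const_mul (α / 2)).sub ((i1.add (i2.const_mul α)).const_mul τ))
  have hlim : Tendsto (fun x : ℝ => rexp (-τ * x) * (x ^ (1/2:ℝ) * (x + α) ^ (-(1:ℝ)/2)))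
      atTop (nhds 0) := by
    have h0 : Tendsto (fun x : ℝ => x ^ (1/2:ℝ) * rexp (-τ * x) * α ^ (-(1:ℝ)/2)) atTop
        (nhds (0 * α ^ (-(1:ℝ)/2))) :=
      (tendsto_rpow_mul_exp_neg_mul_atTop_nhds_zero _ _ hτ).mul_const _
    rw [zero_mul] at h0
    refine squeeze_zero' ?_ ?_ h0
    · filter_upwards [eventually_gt_atTop 0] with x hx
      positivity
    · filter_upwards [eventually_gt_atTop 0] with x hx
      have h := Real.rpow_le_rpow_of_nonpos (z := -(1:ℝ)/2) hα
        (show α ≤ x + α by linarith) (by norm_num)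
      have h0 : 0 ≤ rexp (-τ * x) * x ^ (1/2:ℝ) := by positivity
      nlinarith [mul_le_mul_of_nonneg_left h h0]
  have hcont : ContinuousWithinAt
      (fun x : ℝ => rexp (-τ * x) * (x ^ (1/2:ℝ) * (x + α) ^ (-(1:ℝ)/2))) (Ici 0) 0 := by
    apply ContinuousAt.continuousWithinAt
    have h3 : ContinuousAt (fun x : ℝ => (x + α) ^ (-(1:ℝ)/2)) 0 :=
      (continuousAt_id.add_const α).rpow_const (Or.inl (by simpa using hα.ne'))
    have h2 : ContinuousAt (fun x : ℝ => x ^ (1/2:ℝ)) 0 :=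
      Real.continuousAt_rpow_const _ _ (Or.inr (by norm_num))
    have h1 : ContinuousAt (fun x : ℝ => rexp (-τ * x)) 0 := by fun_prop
    exact h1.mul (h2.mul h3)
  have key := integral_Ioi_of_hasDerivAt_of_tendsto hcont hd hintg hlim
  have e : ∫ x in Ioi (0:ℝ), (α / 2 * laplaceIntegrand α (-1/2) τ x
      - τ * (laplaceIntegrand α (3/2) τ x + α * laplaceIntegrand α (1/2) τ x))
      = α / 2 * laplacePow α (-1/2) τ
        - τ * (laplacePow α (3/2) τ + α * laplacePow α (1/2) τ) := by
    have s1 := integral_sub (i3.const_mul (α / 2)) ((i1.add (i2.const_mul α)).const_mul τ)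
    have s2 := integral_add i1 (i2.const_mul α)
    simp only [Pi.add_apply] at s1
    rw [s1, integral_const_mul, integral_const_mul, s2, integral_const_mul]
    rfl
  rw [e] at key
  have hz : (0:ℝ) ^ (1/2:ℝ) = 0 := Real.zero_rpow (by norm_num)
  rw [hz] at key
  field_simp
  simp only [zero_mul, mul_zero, sub_zero] at key
  linarith

lemma tendsto_laplacePow {α p : ℝ} (hα : 0 < α) (hp : -1 < p) :
    Tendsto (fun τ : ℝ => τ ^ (p + 1) * laplacePow α p τ) atTop
      (nhds (Real.Gamma (p + 1) * α ^ (-(3:ℝ)/2))) := by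
  have hG : ∫ x in Ioi (0:ℝ), rexp (-x) * x ^ p * α ^ (-(3:ℝ)/2)
      = Real.Gamma (p + 1) * α ^ (-(3:ℝ)/2) := by
    rw [integral_mul_const, Real.Gamma_eq_integral (by linarith)]
    simp
  rw [← hG]
  have hconv : Tendsto (fun τ : ℝ => ∫ x in Ioi (0:ℝ),
      rexp (-x) * x ^ p * (x / τ + α) ^ (-(3:ℝ)/2)) atTop
      (nhds (∫ x in Ioi (0:ℝ), rexp (-x) * x ^ p * α ^ (-(3:ℝ)/2))) := by
    refine tendsto_integral_filter_of_dominated_convergence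
      (fun x => rexp (-x) * x ^ p * α ^ (-(3:ℝ)/2)) ?_ ?_ ?_ ?_
    · refine Eventually.of_forall fun τ => Measurable.aestronglyMeasurable ?_
      fun_prop
    · filter_upwards [eventually_gt_atTop 0] with τ hτ
      filter_upwards [ae_restrict_mem measurableSet_Ioi] with x hx
      have hx' : (0:ℝ) < x := hx
      rw [Real.norm_of_nonneg (by positivity)]
      have := add_rpow_le hα (show 0 ≤ x / τ by positivity)
      gcongr
    · have := (Real.GammaIntegral_convergent (s := p + 1) (by linarith)).mul_const (α ^ (-(3:ℝ)/2))
      simpa using this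
    · filter_upwards [ae_restrict_mem measurableSet_Ioi] with x hx
      refine Tendsto.const_mul _ ?_
      have h1 : Tendsto (fun τ : ℝ => x / τ + α) atTop (nhds (0 + α)) :=
        (tendsto_const_nhds.div_atTop tendsto_id).add_const α
      rw [zero_add] at h1
      exact h1.rpow_const (Or.inl hα.ne')
  refine hconv.congr' ?_
  filter_upwards [eventually_gt_atTop 0] with τ hτ
  have hsub := integral_comp_mul_left_Ioi
    (fun x => rexp (-x) * x ^ p * (x / τ + α) ^ (-(3:ℝ)/2)) 0 hτ
  rw [mul_zero, smul_eq_mul] at hsub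
  have hl : ∫ x in Ioi (0:ℝ), rexp (-(τ * x)) * (τ * x) ^ p * (τ * x / τ + α) ^ (-(3:ℝ)/2)
      = τ ^ p * laplacePow α p τ := by
    rw [laplacePow, ← integral_const_mul]
    refine setIntegral_congr_fun measurableSet_Ioi fun x hx => ?_
    have hx' : (0:ℝ) < x := hx
    simp only [laplaceIntegrand]
    rw [Real.mul_rpow hτ.le hx'.le, mul_div_cancel_left₀ _ hτ.ne', neg_mul]
    ring
  rw [hl] at hsub
  rw [Real.rpow_add_one hτ.ne']
  rw [eq_inv_mul_iff_mul_eq₀ hτ.ne'] at hsub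
  linarith

/-- `Y` is a positive function on the half line solving `Y'' = α Y' + α / (2 (1 + t)) Y` for
`t > 0`, with derivative `Y'` and with `Y t ~ W / √(1 + t)` as `t → ∞`. It is extended
continuously to negative times. -/
structure IsDecayingSolution (α W : ℝ) (Y Y' : ℝ → ℝ) : Prop where
  pos : ∀ t, 0 < Y t
  cont : Continuous Y
  cont' : Continuous Y'
  deriv : ∀ t, 0 < t → HasDerivAt Y (Y' t) t
  deriv' : ∀ t, 0 < t → HasDerivAt Y' (α * Y' t + α / 2 / (1 + t) * Y t) t
  lim : Tendsto (fun t => √(1 + t) * Y t) atTop (nhds W)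
  lim' : Tendsto (fun t => (1 + t) * (√(1 + t) * Y' t)) atTop (nhds (-W / 2))

theorem exists_isDecayingSolution {α : ℝ} (hα : 0 < α) :
    ∃ W > 0, ∃ Y Y' : ℝ → ℝ, IsDecayingSolution α W Y Y' := by
  have hτ : ∀ t : ℝ, 0 < 1 + max t 0 := fun t => by positivity
  have hcont : ∀ p : ℝ, -1 < p → Continuous fun t : ℝ => laplacePow α p (1 + max t 0) := by
    intro p hp
    refine continuous_iff_continuousAt.2 fun t => ?_
    exact ContinuousAt.comp (f := fun t : ℝ => 1 + max t 0) (g := laplacePow α p)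
      (hasDerivAt_laplacePow hα hp (hτ t)).continuousAt (by fun_prop)
  have hderiv : ∀ p : ℝ, -1 < p → ∀ t : ℝ, 0 < t → HasDerivAt
      (fun t : ℝ => laplacePow α p (1 + max t 0)) (-laplacePow α (p + 1) (1 + max t 0)) t := by
    intro p hp t ht
    have h1 : HasDerivAt (fun t : ℝ => 1 + max t 0) 1 t := by
      refine ((hasDerivAt_id t).const_add 1).congr_of_eventuallyEq ?_
      filter_upwards [Ioi_mem_nhds ht] with s hs
      simp [max_eq_left (mem_Ioi.1 hs).le]
    exact (HasDerivAt.comp t (hasDerivAt_laplacePow hα hp (hτ t)) h1).congr_deriv (mul_one _)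
  have hlim : ∀ p : ℝ, -1 < p → Tendsto
      (fun t : ℝ => (1 + t) ^ (p + 1) * laplacePow α p (1 + max t 0)) atTop
      (nhds (Real.Gamma (p + 1) * α ^ (-(3:ℝ)/2))) := by
    intro p hp
    have h1 : Tendsto (fun t : ℝ => 1 + t) atTop atTop := tendsto_atTop_add_const_left _ 1 tendsto_id
    refine ((tendsto_laplacePow hα hp).comp h1).congr' ?_
    filter_upwards [eventually_ge_atTop 0] with t ht
    simp [max_eq_left ht]
  refine ⟨Real.Gamma (1/2) * α ^ (-(3:ℝ)/2), ?_,
    fun t => laplacePow α (-1/2) (1 + max t 0), fun t => -laplacePow α (1/2) (1 + max t 0),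
    ⟨fun t => laplacePow_pos hα (by norm_num) (hτ t), hcont _ (by norm_num),
      (hcont _ (by norm_num)).neg, fun t ht => ?_, fun t ht => ?_, ?_, ?_⟩⟩
  · have := Real.Gamma_pos_of_pos (show (0:ℝ) < 1/2 by norm_num)
    positivity
  · refine (hderiv (-1/2) (by norm_num) t ht).congr_deriv ?_
    norm_num
  · refine (hderiv (1/2) (by norm_num) t ht).neg.congr_deriv ?_
    have h := laplacePow_ode hα (hτ t)
    have e : (1/2:ℝ) + 1 = 3/2 := by norm_num
    rw [neg_neg, e, h, max_eq_left ht.le]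
    ring
  · have h := hlim (-1/2) (by norm_num)
    have e : (-1/2:ℝ) + 1 = 1/2 := by norm_num
    rw [e] at h
    simpa only [Real.sqrt_eq_rpow] using h
  · have h := (hlim (1/2) (by norm_num)).neg
    have e : Real.Gamma ((1/2:ℝ) + 1) = 1/2 * Real.Gamma (1/2) :=
      Real.Gamma_add_one (by norm_num)
    rw [e] at h
    have e2 : -(1 / 2 * Real.Gamma (1/2) * α ^ (-(3:ℝ)/2))
        = -(Real.Gamma (1/2) * α ^ (-(3:ℝ)/2)) / 2 := by ring
    rw [e2] at h
    refine h.congr' ?_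
    filter_upwards [eventually_gt_atTop 0] with t ht
    have ht' : 0 < 1 + t := by linarith
    rw [Real.sqrt_eq_rpow, Real.rpow_add_one ht'.ne']
    ring

lemma eventually_le_mul_of_deriv_le {f g f' g' : ℝ → ℝ} {M ε : ℝ} (hε : 0 < ε)
    (hf : ∀ᶠ t in atTop, HasDerivAt f (f' t) t) (hg : ∀ᶠ t in atTop, HasDerivAt g (g' t) t)
    (hle : ∀ᶠ t in atTop, f' t ≤ M * g' t) (hlim : Tendsto g atTop atTop) :
    ∀ᶠ t in atTop, f t ≤ (M + ε) * g t := by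
  obtain ⟨T, hT⟩ := eventually_atTop.1 (hf.and (hg.and hle))
  have hd : ∀ t ∈ Ici T, HasDerivAt (fun t => f t - M * g t) (f' t - M * g' t) t :=
    fun t ht => (hT t ht).1.sub ((hT t ht).2.1.const_mul M)
  have hanti : AntitoneOn (fun t => f t - M * g t) (Ici T) := by
    refine antitoneOn_of_deriv_nonpos (convex_Ici T)
      (fun t ht => (hd t ht).continuousAt.continuousWithinAt)
      (fun t ht => (hd t (interior_subset ht)).differentiableAt.differentiableWithinAt)
      fun t ht => ?_
    rw [(hd t (interior_subset ht)).deriv]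
    linarith [(hT t (interior_subset ht)).2.2]
  filter_upwards [eventually_ge_atTop T,
    hlim.eventually_ge_atTop ((f T - M * g T) / ε)] with t ht hgt
  have h1 : f t - M * g t ≤ f T - M * g T := hanti (mem_Ici.2 le_rfl) ht ht
  rw [div_le_iff₀ hε] at hgt
  linarith

/-- L'Hôpital's rule at infinity for a denominator tending to infinity. -/
theorem tendsto_div_of_tendsto_deriv_div {f g f' g' : ℝ → ℝ} {L : ℝ}
    (hf : ∀ᶠ t in atTop, HasDerivAt f (f' t) t) (hg : ∀ᶠ t in atTop, HasDerivAt g (g' t) t)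
    (hpos : ∀ᶠ t in atTop, 0 < g' t) (hlim : Tendsto g atTop atTop)
    (hdiv : Tendsto (fun t => f' t / g' t) atTop (nhds L)) :
    Tendsto (fun t => f t / g t) atTop (nhds L) := by
  rw [Metric.tendsto_nhds]
  intro ε hε
  have h1 : ∀ᶠ t in atTop, f' t ≤ (L + ε / 4) * g' t := by
    filter_upwards [hpos, hdiv.eventually_le_const (show L < L + ε / 4 by linarith)] with t ht h
    rwa [div_le_iff₀ ht] at h
  have h2 : ∀ᶠ t in atTop, -f' t ≤ (-L + ε / 4) * g' t := by
    filter_upwards [hpos, hdiv.eventually_const_le (show L - ε / 4 < L by linarith)] with t ht h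
    rw [le_div_iff₀ ht] at h
    linarith
  filter_upwards [eventually_le_mul_of_deriv_le (show 0 < ε / 4 by linarith) hf hg h1 hlim,
    eventually_le_mul_of_deriv_le (show 0 < ε / 4 by linarith)
      (hf.mono fun t ht => ht.fun_neg) hg h2 hlim, hlim.eventually_gt_atTop 0] with t h3 h4 h5
  have h6 : f t / g t ≤ L + ε / 4 + ε / 4 := by rwa [div_le_iff₀ h5]
  have h7 : L - ε / 4 - ε / 4 ≤ f t / g t := by
    rw [le_div_iff₀ h5]; linarith
  rw [Real.dist_eq, abs_lt]
  constructor <;> linarith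

/-- The fundamental solution of `v' = -(α - Y' / Y) v`. -/
def decayFactor (α : ℝ) (Y : ℝ → ℝ) (t : ℝ) : ℝ := rexp (-(α * t)) * Y t

/-- The weight `1 / (Y * decayFactor α Y)`. -/
def memoryWeight (α : ℝ) (Y : ℝ → ℝ) (t : ℝ) : ℝ := rexp (α * t) / Y t ^ 2

/-- The relaxation rate `α - Y' / Y`. -/
def relaxRate (α : ℝ) (Y Y' : ℝ → ℝ) (t : ℝ) : ℝ := α - Y' t / Y t

/-- The solution `j` of `j' = G / Y - (α - Y' / Y) j` with `j 0 = 0`. -/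
def memoryInt (α : ℝ) (Y G : ℝ → ℝ) (t : ℝ) : ℝ :=
  decayFactor α Y t * ∫ u in (0:ℝ)..t, memoryWeight α Y u * G u

/-- The derivative of `memoryInt α Y G`. -/
def memoryRate (α : ℝ) (Y Y' G : ℝ → ℝ) (t : ℝ) : ℝ :=
  G t / Y t - relaxRate α Y Y' t * memoryInt α Y G t

lemma tendsto_one_add_atTop : Tendsto (fun t : ℝ => 1 + t) atTop atTop :=
  tendsto_atTop_add_const_left _ 1 tendsto_id

namespace IsDecayingSolution

variable {α W : ℝ} {Y Y' : ℝ → ℝ}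

lemma tendsto_mul_logDeriv (h : IsDecayingSolution α W Y Y') (hW : 0 < W) :
    Tendsto (fun t => (1 + t) * (Y' t / Y t)) atTop (nhds (-1 / 2)) := by
  have h1 := h.lim'.div h.lim hW.ne'
  have e : -W / 2 / W = -1 / 2 := by field_simp
  rw [e] at h1
  refine h1.congr' ?_
  filter_upwards [eventually_gt_atTop 0] with t ht
  have := h.pos t
  have h2 : 0 < √(1 + t) := Real.sqrt_pos.2 (by linarith)
  simp only [Pi.div_apply]
  field_simp

lemma tendsto_logDeriv (h : IsDecayingSolution α W Y Y') (hW : 0 < W) :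
    Tendsto (fun t => Y' t / Y t) atTop (nhds 0) := by
  have h1 := (h.tendsto_mul_logDeriv hW).mul tendsto_one_add_atTop.inv_tendsto_atTop
  rw [mul_zero] at h1
  refine h1.congr' ?_
  filter_upwards [eventually_gt_atTop 0] with t ht
  have : 0 < 1 + t := by linarith
  simp only [Pi.inv_apply]
  field_simp

lemma tendsto_relaxRate (h : IsDecayingSolution α W Y Y') (hW : 0 < W) :
    Tendsto (relaxRate α Y Y') atTop (nhds α) := by
  have := (h.tendsto_logDeriv hW).const_sub α
  rwa [sub_zero] at this

lemma decayFactor_pos (h : IsDecayingSolution α W Y Y') (t : ℝ) : 0 < decayFactor α Y t :=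
  mul_pos (Real.exp_pos _) (h.pos t)

lemma memoryWeight_eq (h : IsDecayingSolution α W Y Y') (t : ℝ) :
    memoryWeight α Y t = 1 / (Y t * decayFactor α Y t) := by
  have := h.pos t
  unfold memoryWeight decayFactor
  rw [Real.exp_neg]
  have := Real.exp_pos (α * t)
  field_simp

lemma continuous_decayFactor (h : IsDecayingSolution α W Y Y') :
    Continuous (decayFactor α Y) := by
  have := h.cont
  unfold decayFactor; fun_prop

lemma continuous_memoryWeight (h : IsDecayingSolution α W Y Y') :
    Continuous (memoryWeight α Y) := by
  have := h.cont
  unfold memoryWeight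
  exact Continuous.div (by fun_prop) (by fun_prop) fun t => (pow_pos (h.pos t) 2).ne'

lemma hasDerivAt_decayFactor (h : IsDecayingSolution α W Y Y') {t : ℝ} (ht : 0 < t) :
    HasDerivAt (decayFactor α Y) (-(relaxRate α Y Y' t * decayFactor α Y t)) t := by
  have h1 : HasDerivAt (fun t : ℝ => -(α * t)) (-(α * 1)) t :=
    ((hasDerivAt_id t).const_mul α).neg
  refine (h1.exp.mul (h.deriv t ht)).congr_deriv ?_
  have := h.pos t
  unfold relaxRate decayFactor
  field_simp
  ring

lemma hasDerivAt_relaxRate (h : IsDecayingSolution α W Y Y') {t : ℝ} (ht : 0 < t) :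
    HasDerivAt (relaxRate α Y Y')
      ((Y' t / Y t) ^ 2 - α * (Y' t / Y t) - α / 2 / (1 + t)) t := by
  have hY := h.pos t
  have ht' : 0 < 1 + t := by linarith
  refine (((h.deriv' t ht).div (h.deriv t ht) hY.ne').const_sub α).congr_deriv ?_
  field_simp
  ring

lemma hasDerivAt_memoryInt (h : IsDecayingSolution α W Y Y') {G : ℝ → ℝ} (hG : Continuous G)
    {t : ℝ} (ht : 0 < t) :
    HasDerivAt (memoryInt α Y G) (memoryRate α Y Y' G t) t := by
  have h1 := (Continuous.integral_hasStrictDerivAt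
    (h.continuous_memoryWeight.mul hG) 0 t).hasDerivAt
  refine ((h.hasDerivAt_decayFactor ht).mul h1).congr_deriv ?_
  have := h.pos t
  have h2 := h.decayFactor_pos t
  simp only [Pi.mul_apply]
  rw [h.memoryWeight_eq t]
  unfold memoryRate memoryInt
  field_simp
  ring

lemma tendsto_exp_mul_div (h : IsDecayingSolution α W Y Y') (hα : 0 < α) (hW : 0 < W)
    {φ : ℝ → ℝ} (hφ : ∀ᶠ t in atTop, 1 ≤ √(1 + t) * φ t) :
    Tendsto (fun t => φ t / decayFactor α Y t) atTop atTop := by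
  have h1 : Tendsto (fun t : ℝ => rexp (α * t) * (1 / (2 * W))) atTop atTop :=
    (Real.tendsto_exp_atTop.comp (tendsto_id.const_mul_atTop hα)).atTop_mul_const (by positivity)
  refine tendsto_atTop_mono' _ ?_ h1
  filter_upwards [hφ, h.lim.eventually_le_const (show W < 2 * W by linarith),
    eventually_gt_atTop 0] with t h2 h3 ht
  have hs : 0 < √(1 + t) := Real.sqrt_pos.2 (by linarith)
  have hY := h.pos t
  unfold decayFactor
  rw [Real.exp_neg]
  have he := Real.exp_pos (α * t)
  have e : φ t / ((rexp (α * t))⁻¹ * Y t)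
      = rexp (α * t) * ((√(1 + t) * φ t) / (√(1 + t) * Y t)) := by
    field_simp
  rw [e]
  gcongr

/-- Asymptotics of solutions of `y' = k - (α - Y' / Y) y` against a slowly varying gauge. -/
theorem tendsto_div_gauge (h : IsDecayingSolution α W Y Y') (hα : 0 < α) (hW : 0 < W)
    {y k φ φ' : ℝ → ℝ} {L : ℝ}
    (hy : ∀ᶠ t in atTop, HasDerivAt y (k t - relaxRate α Y Y' t * y t) t)
    (hφd : ∀ᶠ t in atTop, HasDerivAt φ (φ' t) t)
    (hφ : ∀ᶠ t in atTop, 1 ≤ √(1 + t) * φ t)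
    (hk : Tendsto (fun t => k t / φ t) atTop (nhds L))
    (hφ0 : Tendsto (fun t => φ' t / φ t) atTop (nhds 0)) :
    Tendsto (fun t => y t / φ t) atTop (nhds (L / α)) := by
  have hφpos : ∀ᶠ t in atTop, 0 < φ t := by
    filter_upwards [hφ] with t ht
    exact pos_of_mul_pos_right (by linarith) (Real.sqrt_nonneg _)
  have hden : Tendsto (fun t => φ' t / φ t + relaxRate α Y Y' t) atTop (nhds α) := by
    simpa using hφ0.add (h.tendsto_relaxRate hW)
  have key := tendsto_div_of_tendsto_deriv_div (f := fun t => y t / decayFactor α Y t)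
    (g := fun t => φ t / decayFactor α Y t) (f' := fun t => k t / decayFactor α Y t)
    (g' := fun t => φ t / decayFactor α Y t * (φ' t / φ t + relaxRate α Y Y' t))
    (L := L / α) ?_ ?_ ?_ (h.tendsto_exp_mul_div hα hW hφ) ?_
  · refine key.congr fun t => ?_
    exact div_div_div_cancel_right₀ (h.decayFactor_pos t).ne' _ _
  · filter_upwards [hy, eventually_gt_atTop 0] with t h1 ht
    have h2 := h.decayFactor_pos t
    refine (h1.div (h.hasDerivAt_decayFactor ht) h2.ne').congr_deriv ?_
    field_simp
    ring
  · filter_upwards [hφd, hφpos, eventually_gt_atTop 0] with t h1 h3 ht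
    have h2 := h.decayFactor_pos t
    refine (h1.div (h.hasDerivAt_decayFactor ht) h2.ne').congr_deriv ?_
    field_simp
    ring
  · filter_upwards [hφpos, hden.eventually_const_lt hα] with t h1 h2
    exact mul_pos (div_pos h1 (h.decayFactor_pos t)) h2
  · refine (hk.div hden hα.ne').congr' ?_
    filter_upwards [hφpos, hden.eventually_const_lt hα] with t h1 h2
    have h3 := h.decayFactor_pos t
    simp only [Pi.div_apply]
    field_simp

theorem tendsto_memoryRate (h : IsDecayingSolution α W Y Y') (hα : 0 < α) (hW : 0 < W)
    {G G' l l' : ℝ → ℝ} {K : ℝ} (hG : Continuous G) (hGd : ∀ t, 0 < t → HasDerivAt G (G' t) t)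
    (hl : ∀ t, 0 < t → HasDerivAt l (l' t) t) (hl1 : ∀ᶠ t in atTop, 1 ≤ l t)
    (hl' : Tendsto (fun t => l' t / l t) atTop (nhds 0))
    (hGl : Tendsto (fun t => G t / l t) atTop (nhds K))
    (hGl' : Tendsto (fun t => √(1 + t) * (G' t / Y t) / l t) atTop (nhds 0)) :
    Tendsto (fun t => √(1 + t) * memoryRate α Y Y' G t / l t) atTop
      (nhds (K / (2 * W * α))) := by
  have hsd : ∀ t : ℝ, 0 < t → HasDerivAt (fun t : ℝ => √(1 + t)) (1 / (2 * √(1 + t))) t :=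
    fun t ht => ((hasDerivAt_id t).const_add 1).sqrt (by simp; linarith)
  have hinv : Tendsto (fun t : ℝ => 1 / (2 * (1 + t))) atTop (nhds 0) :=
    tendsto_const_nhds.div_atTop (tendsto_one_add_atTop.const_mul_atTop two_pos)
  have hj : Tendsto (fun t => memoryInt α Y G t / (√(1 + t) * l t)) atTop
      (nhds (K / W / α)) := by
    refine h.tendsto_div_gauge hα hW (k := fun t => G t / Y t)
      (φ' := fun t => 1 / (2 * √(1 + t)) * l t + √(1 + t) * l' t) ?_ ?_ ?_ ?_ ?_
    · filter_upwards [eventually_gt_atTop 0] with t ht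
      exact h.hasDerivAt_memoryInt hG ht
    · filter_upwards [eventually_gt_atTop 0] with t ht
      exact (hsd t ht).mul (hl t ht)
    · filter_upwards [hl1, eventually_gt_atTop 0] with t h1 ht
      rw [← mul_assoc, Real.mul_self_sqrt (by linarith)]
      nlinarith
    · refine (hGl.div h.lim hW.ne').congr' ?_
      filter_upwards [eventually_gt_atTop 0] with t ht
      simp only [Pi.div_apply]
      rw [div_div, div_div]
      congr 1
      ring
    · have := hinv.add hl'
      rw [add_zero] at this
      refine this.congr' ?_
      filter_upwards [hl1, eventually_gt_atTop 0] with t h1 ht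
      have hs : 0 < √(1 + t) := Real.sqrt_pos.2 (by linarith)
      have hl0 : 0 < l t := by linarith
      have hsq : 1 + t = √(1 + t) ^ 2 := (Real.sq_sqrt (by linarith)).symm
      nth_rewrite 1 [hsq]
      field_simp
  have hρ : Tendsto (fun t => (1 + t) * ((Y' t / Y t) ^ 2 - α * (Y' t / Y t) - α / 2 / (1 + t)))
      atTop (nhds 0) := by
    have h1 := ((h.tendsto_mul_logDeriv hW).mul (h.tendsto_logDeriv hW)).sub
      ((h.tendsto_mul_logDeriv hW).const_mul α)
    have h2 := h1.sub_const (α / 2)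
    have e : -1 / 2 * 0 - α * (-1 / 2) - α / 2 = 0 := by ring
    rw [e] at h2
    refine h2.congr' ?_
    filter_upwards [eventually_gt_atTop 0] with t ht
    have : 0 < 1 + t := by linarith
    field_simp
  have key : Tendsto (fun t => memoryRate α Y Y' G t / (l t / √(1 + t))) atTop
      (nhds (K / (2 * W) / α)) := by
    refine h.tendsto_div_gauge hα hW
      (k := fun t => G' t / Y t - G t * Y' t / Y t ^ 2
        - ((Y' t / Y t) ^ 2 - α * (Y' t / Y t) - α / 2 / (1 + t)) * memoryInt α Y G t)
      (φ' := fun t => (l' t * √(1 + t) - l t * (1 / (2 * √(1 + t)))) / √(1 + t) ^ 2)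
      ?_ ?_ ?_ ?_ ?_
    · filter_upwards [eventually_gt_atTop 0] with t ht
      have hY := h.pos t
      refine (((hGd t ht).div (h.deriv t ht) hY.ne').sub
        ((h.hasDerivAt_relaxRate ht).mul (h.hasDerivAt_memoryInt hG ht))).congr_deriv ?_
      field_simp
      ring
    · filter_upwards [eventually_gt_atTop 0] with t ht
      exact (hl t ht).div (hsd t ht) (Real.sqrt_pos.2 (by linarith)).ne'
    · filter_upwards [hl1, eventually_gt_atTop 0] with t h1 ht
      rwa [mul_div_cancel₀ _ (Real.sqrt_pos.2 (by linarith)).ne']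
    · have h1 := (hGl'.sub ((hGl.mul (h.tendsto_mul_logDeriv hW)).div h.lim hW.ne')).sub
        (hρ.mul hj)
      have e : 0 - K * (-1 / 2) / W - 0 * (K / W / α) = K / (2 * W) := by
        field_simp; ring
      rw [e] at h1
      refine h1.congr' ?_
      filter_upwards [hl1, eventually_gt_atTop 0] with t h1 ht
      have hs : 0 < √(1 + t) := Real.sqrt_pos.2 (by linarith)
      have hl0 : 0 < l t := by linarith
      have hY := h.pos t
      have hsq : 1 + t = √(1 + t) ^ 2 := (Real.sq_sqrt (by linarith)).symm
      generalize hr : (Y' t / Y t) ^ 2 - α * (Y' t / Y t) - α / 2 / (1 + t) = r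
      simp only [Pi.div_apply]
      generalize hs' : √(1 + t) = s at *
      rw [hsq]
      field_simp
    · have := hl'.sub hinv
      rw [sub_zero] at this
      refine this.congr' ?_
      filter_upwards [hl1, eventually_gt_atTop 0] with t h1 ht
      have hs : 0 < √(1 + t) := Real.sqrt_pos.2 (by linarith)
      have hl0 : 0 < l t := by linarith
      have hsq : 1 + t = √(1 + t) ^ 2 := (Real.sq_sqrt (by linarith)).symm
      generalize hs' : √(1 + t) = s at *
      rw [hsq]
      field_simp
  have e : K / (2 * W) / α = K / (2 * W * α) := by rw [div_div]
  rw [e] at key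
  refine key.congr' ?_
  filter_upwards [hl1, eventually_gt_atTop 0] with t h1 ht
  have hs : 0 < √(1 + t) := Real.sqrt_pos.2 (by linarith)
  field_simp

lemma tendsto_sqrt_mul_decayFactor (h : IsDecayingSolution α W Y Y') (hα : 0 < α) :
    Tendsto (fun t => √(1 + t) * decayFactor α Y t) atTop (nhds 0) := by
  have h1 : Tendsto (fun t : ℝ => rexp (-(α * t))) atTop (nhds 0) :=
    Real.tendsto_exp_neg_atTop_nhds_zero.comp (tendsto_id.const_mul_atTop hα)
  have h2 := h1.mul h.lim
  rw [zero_mul] at h2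
  refine h2.congr fun t => ?_
  unfold decayFactor
  ring

lemma tendsto_memoryRate_one (h : IsDecayingSolution α W Y Y') (hα : 0 < α) (hW : 0 < W) :
    Tendsto (fun t => √(1 + t) * memoryRate α Y Y' (fun _ => 1) t) atTop
      (nhds (1 / (2 * W * α))) := by
  have := h.tendsto_memoryRate hα hW (G := fun _ => 1) (G' := fun _ => 0) (l := fun _ => 1)
    (l' := fun _ => 0) (K := 1) continuous_const (fun t _ => hasDerivAt_const _ _)
    (fun t _ => hasDerivAt_const _ _) (Eventually.of_forall fun _ => le_rfl) (by simp) (by simp)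
    (by simp)
  simpa using this

lemma tendsto_memoryRate_integral_sq (h : IsDecayingSolution α W Y Y') (hα : 0 < α)
    (hW : 0 < W) :
    Tendsto (fun t => √(1 + t) * memoryRate α Y Y' (fun t => ∫ u in (0:ℝ)..t, Y u ^ 2) t
      / Real.log (1 + t)) atTop (nhds (W / (2 * α))) := by
  have hcont : Continuous fun t => Y t ^ 2 := h.cont.pow 2
  have hVd : ∀ t, HasDerivAt (fun t => ∫ u in (0:ℝ)..t, Y u ^ 2) (Y t ^ 2) t := fun t =>
    (hcont.integral_hasStrictDerivAt 0 t).hasDerivAt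
  have hlog : ∀ t : ℝ, 0 < t → HasDerivAt (fun t : ℝ => Real.log (1 + t)) (1 / (1 + t)) t :=
    fun t ht => ((hasDerivAt_id t).const_add 1).log (by simp; linarith)
  have hlogtop : Tendsto (fun t : ℝ => Real.log (1 + t)) atTop atTop :=
    Real.tendsto_log_atTop.comp tendsto_one_add_atTop
  have e : W / (2 * α) = W ^ 2 / (2 * W * α) := by field_simp
  rw [e]
  refine h.tendsto_memoryRate hα hW
    (continuous_iff_continuousAt.2 fun t => (hVd t).continuousAt) (fun t _ => hVd t) hlog
    (hlogtop.eventually_ge_atTop 1) ?_ ?_ ?_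
  · have := tendsto_one_add_atTop.inv_tendsto_atTop.mul hlogtop.inv_tendsto_atTop
    rw [zero_mul] at this
    refine this.congr fun t => ?_
    simp [div_eq_mul_inv]
  · refine tendsto_div_of_tendsto_deriv_div (Eventually.of_forall hVd)
      ((eventually_gt_atTop 0).mono hlog) ?_ hlogtop ?_
    · filter_upwards [eventually_gt_atTop 0] with t ht
      positivity
    · refine (h.lim.pow 2).congr' ?_
      filter_upwards [eventually_gt_atTop 0] with t ht
      rw [mul_pow, Real.sq_sqrt (by linarith)]
      field_simp
  · refine (h.lim.div_atTop hlogtop).congr fun t => ?_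
    have := h.pos t
    field_simp

end IsDecayingSolution

/-- A measurable process with continuous paths whose second moments are bounded on compact time
intervals. -/
structure IsSecondOrder {Ω : Type*} {mΩ : MeasurableSpace Ω} (P : Measure Ω) (A : ℝ → Ω → ℝ) :
    Prop where
  meas : ∀ t, Measurable (A t)
  cont : ∀ ω, Continuous fun t => A t ω
  bdd : ∀ T, ∃ C, ∀ t ∈ Icc 0 T, MemLp (A t) 2 P ∧ ∫ ω, A t ω ^ 2 ∂P ≤ C

lemma sq_intervalIntegral_le {f : ℝ → ℝ} (hf : Continuous f) {t : ℝ} (ht : 0 ≤ t) :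
    (∫ u in (0:ℝ)..t, f u) ^ 2 ≤ t * ∫ u in (0:ℝ)..t, f u ^ 2 := by
  rcases ht.eq_or_lt with rfl | ht'
  · simp
  set m := (∫ u in (0:ℝ)..t, f u) / t with hm
  have h0 : 0 ≤ ∫ u in (0:ℝ)..t, (f u - m) ^ 2 :=
    intervalIntegral.integral_nonneg ht fun u _ => sq_nonneg _
  have h1 : ∫ u in (0:ℝ)..t, (f u - m) ^ 2
      = (∫ u in (0:ℝ)..t, f u ^ 2) - 2 * m * (∫ u in (0:ℝ)..t, f u) + t * m ^ 2 := by
    have e : ∀ u, (f u - m) ^ 2 = f u ^ 2 - 2 * m * f u + m ^ 2 := fun u => by ring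
    simp_rw [e]
    rw [intervalIntegral.integral_add (Continuous.intervalIntegrable (by fun_prop) _ _)
      (Continuous.intervalIntegrable (by fun_prop) _ _),
      intervalIntegral.integral_sub (Continuous.intervalIntegrable (by fun_prop) _ _)
      (Continuous.intervalIntegrable (by fun_prop) _ _), intervalIntegral.integral_const_mul]
    simp
  have h2 : (∫ u in (0:ℝ)..t, f u) = m * t := by rw [hm]; field_simp
  rw [h1, h2] at h0
  rw [h2]
  nlinarith

namespace IsSecondOrder

variable {Ω : Type*} {mΩ : MeasurableSpace Ω} {P : Measure Ω} {A A' : ℝ → Ω → ℝ}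

lemma memLp (h : IsSecondOrder P A) {t : ℝ} (ht : 0 ≤ t) : MemLp (A t) 2 P := by
  obtain ⟨C, hC⟩ := h.bdd t
  exact (hC t ⟨ht, le_rfl⟩).1

lemma measurable_uncurry (h : IsSecondOrder P A) : Measurable (Function.uncurry A) :=
  measurable_uncurry_of_continuous_of_measurable h.cont h.meas

lemma integrable_sq_prod [IsFiniteMeasure P] (h : IsSecondOrder P A) (T : ℝ) :
    Integrable (fun p : ℝ × Ω => A p.1 p.2 ^ 2) ((volume.restrict (Ioc 0 T)).prod P) := by
  obtain ⟨C, hC⟩ := h.bdd T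
  have hm : Measurable fun p : ℝ × Ω => A p.1 p.2 ^ 2 := h.measurable_uncurry.pow_const 2
  rw [integrable_prod_iff hm.aestronglyMeasurable]
  constructor
  · filter_upwards [ae_restrict_mem measurableSet_Ioc] with t ht
    exact (hC t ⟨ht.1.le, ht.2⟩).1.integrable_sq
  · refine Integrable.mono' (integrable_const C) ?_ ?_
    · exact hm.norm.stronglyMeasurable.integral_prod_right.aestronglyMeasurable
    · filter_upwards [ae_restrict_mem measurableSet_Ioc] with t ht
      rw [Real.norm_of_nonneg (integral_nonneg fun _ => norm_nonneg _)]
      simpa using (hC t ⟨ht.1.le, ht.2⟩).2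

lemma integrable_mul_prod [IsFiniteMeasure P] (h : IsSecondOrder P A) {U : Ω → ℝ}
    (hUm : Measurable U) (hU : MemLp U 2 P) (T : ℝ) :
    Integrable (fun p : ℝ × Ω => U p.2 * A p.1 p.2) ((volume.restrict (Ioc 0 T)).prod P) := by
  have hU2 : Integrable (fun p : ℝ × Ω => U p.2 ^ 2) ((volume.restrict (Ioc 0 T)).prod P) :=
    hU.integrable_sq.comp_snd _
  refine Integrable.mono' (hU2.add (h.integrable_sq_prod T)) ?_ ?_
  · exact ((hUm.comp measurable_snd).mul h.measurable_uncurry).aestronglyMeasurable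
  · refine Eventually.of_forall fun p => ?_
    rw [Real.norm_eq_abs, abs_le]
    simp only [Pi.add_apply]
    constructor <;>
      nlinarith [sq_nonneg (U p.2 + A p.1 p.2), sq_nonneg (U p.2 - A p.1 p.2),
        sq_nonneg (U p.2), sq_nonneg (A p.1 p.2)]

lemma integral_mul_primitive [IsFiniteMeasure P] (h : IsSecondOrder P A) {U : Ω → ℝ}
    (hUm : Measurable U) (hU : MemLp U 2 P) {T : ℝ} (hT : 0 ≤ T) :
    ∫ ω, U ω * (∫ u in (0:ℝ)..T, A u ω) ∂P = ∫ u in (0:ℝ)..T, ∫ ω, U ω * A u ω ∂P := by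
  rw [intervalIntegral.integral_of_le hT]
  rw [integral_integral_swap (f := fun u ω => U ω * A u ω) (h.integrable_mul_prod hUm hU T)]
  refine integral_congr_ae (Eventually.of_forall fun ω => ?_)
  simp only [intervalIntegral.integral_of_le hT, integral_const_mul]

lemma intervalIntegrable_integral_mul [IsFiniteMeasure P] (h : IsSecondOrder P A) {U : Ω → ℝ}
    (hUm : Measurable U) (hU : MemLp U 2 P) {T : ℝ} (hT : 0 ≤ T) :
    IntervalIntegrable (fun u => ∫ ω, U ω * A u ω ∂P) volume 0 T := by
  rw [intervalIntegrable_iff_integrableOn_Ioc_of_le hT]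
  exact (h.integrable_mul_prod hUm hU T).integral_prod_left

lemma continuous_primitive_path (h : IsSecondOrder P A) (ω : Ω) :
    Continuous fun t => ∫ u in (0:ℝ)..t, A u ω :=
  intervalIntegral.continuous_primitive (fun a b => (h.cont ω).intervalIntegrable a b) 0

lemma primitive [IsFiniteMeasure P] (h : IsSecondOrder P A) :
    IsSecondOrder P fun t ω => ∫ u in (0:ℝ)..t, A u ω := by
  have hmeas : ∀ t, Measurable fun ω => ∫ u in (0:ℝ)..t, A u ω := by
    intro t
    simp only [intervalIntegral]
    have h1 := h.measurable_uncurry.stronglyMeasurable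
    exact ((h1.integral_prod_left (μ := volume.restrict (Ioc 0 t))).measurable).sub
      ((h1.integral_prod_left (μ := volume.restrict (Ioc t 0))).measurable)
  refine ⟨hmeas, h.continuous_primitive_path, fun T => ?_⟩
  obtain ⟨C, hC⟩ := h.bdd T
  refine ⟨T * (T * |C|), fun t ht => ?_⟩
  have ht0 : 0 ≤ t := ht.1
  have hintg : Integrable (fun ω => ∫ u in (0:ℝ)..t, A u ω ^ 2) P := by
    simp only [intervalIntegral.integral_of_le ht0]
    exact (h.integrable_sq_prod t).integral_prod_right
  have hle : ∀ ω, (∫ u in (0:ℝ)..t, A u ω) ^ 2 ≤ t * ∫ u in (0:ℝ)..t, A u ω ^ 2 :=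
    fun ω => sq_intervalIntegral_le (h.cont ω) ht0
  have hsq : Integrable (fun ω => (∫ u in (0:ℝ)..t, A u ω) ^ 2) P := by
    refine Integrable.mono' (hintg.const_mul t) ((hmeas t).pow_const 2).aestronglyMeasurable
      (Eventually.of_forall fun ω => ?_)
    rw [Real.norm_of_nonneg (sq_nonneg _)]
    exact hle ω
  refine ⟨(memLp_two_iff_integrable_sq (hmeas t).aestronglyMeasurable).2 hsq, ?_⟩
  have h1 : ∫ ω, (∫ u in (0:ℝ)..t, A u ω) ^ 2 ∂P
      ≤ t * ∫ ω, (∫ u in (0:ℝ)..t, A u ω ^ 2) ∂P := by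
    rw [← integral_const_mul]
    exact integral_mono hsq (hintg.const_mul t) hle
  have h2 : ∫ ω, (∫ u in (0:ℝ)..t, A u ω ^ 2) ∂P = ∫ u in (0:ℝ)..t, ∫ ω, A u ω ^ 2 ∂P := by
    simp only [intervalIntegral.integral_of_le ht0]
    exact (integral_integral_swap (f := fun u ω => A u ω ^ 2) (h.integrable_sq_prod t)).symm
  have h3 : ∫ u in (0:ℝ)..t, ∫ ω, A u ω ^ 2 ∂P ≤ |C| * |t - 0| := by
    refine (Real.le_norm_self _).trans
      (intervalIntegral.norm_integral_le_of_norm_le_const fun u hu => ?_)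
    rw [uIoc_of_le ht0] at hu
    rw [Real.norm_of_nonneg (integral_nonneg fun _ => sq_nonneg _)]
    exact (hC u ⟨hu.1.le, hu.2.trans ht.2⟩).2.trans (le_abs_self C)
  rw [sub_zero, abs_of_nonneg ht0] at h3
  have hT : t ≤ T := ht.2
  have hT0 : 0 ≤ T := ht0.trans hT
  calc _ ≤ t * (|C| * t) := h1.trans (by rw [h2]; gcongr)
    _ ≤ T * (T * |C|) := by
      rw [mul_comm |C|]
      have := abs_nonneg C
      gcongr

lemma smul (h : IsSecondOrder P A) {d : ℝ → ℝ} (hd : Continuous d) :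
    IsSecondOrder P fun t ω => d t * A t ω := by
  refine ⟨fun t => (h.meas t).const_mul _, fun ω => hd.mul (h.cont ω), fun T => ?_⟩
  obtain ⟨C, hC⟩ := h.bdd T
  obtain ⟨K, hK⟩ := isCompact_Icc.exists_bound_of_continuousOn (s := Icc 0 T) hd.continuousOn
  refine ⟨K ^ 2 * |C|, fun t ht => ⟨(hC t ht).1.const_mul _, ?_⟩⟩
  simp only [mul_pow]
  rw [integral_const_mul]
  have h1 : d t ^ 2 ≤ K ^ 2 := by
    rw [← sq_abs]
    exact pow_le_pow_left₀ (abs_nonneg _) (hK t ht) 2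
  have h2 := (hC t ht).2.trans (le_abs_self C)
  have h3 : 0 ≤ ∫ ω, A t ω ^ 2 ∂P := integral_nonneg fun _ => sq_nonneg _
  gcongr

lemma sub (h : IsSecondOrder P A) (h' : IsSecondOrder P A') :
    IsSecondOrder P fun t ω => A t ω - A' t ω := by
  refine ⟨fun t => (h.meas t).sub (h'.meas t), fun ω => (h.cont ω).sub (h'.cont ω), fun T => ?_⟩
  obtain ⟨C, hC⟩ := h.bdd T
  obtain ⟨C', hC'⟩ := h'.bdd T
  refine ⟨2 * C + 2 * C', fun t ht => ?_⟩
  have h1 := (hC t ht).1.integrable_sq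
  have h2 := (hC' t ht).1.integrable_sq
  have hm := (hC t ht).1.sub (hC' t ht).1
  refine ⟨hm, ?_⟩
  calc ∫ ω, (A t ω - A' t ω) ^ 2 ∂P ≤ ∫ ω, (2 * A t ω ^ 2 + 2 * A' t ω ^ 2) ∂P :=
        integral_mono hm.integrable_sq ((h1.const_mul 2).add (h2.const_mul 2)) fun ω => by
          nlinarith [sq_nonneg (A t ω + A' t ω)]
    _ = 2 * ∫ ω, A t ω ^ 2 ∂P + 2 * ∫ ω, A' t ω ^ 2 ∂P := by
        rw [integral_add (h1.const_mul 2) (h2.const_mul 2), integral_const_mul, integral_const_mul]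
    _ ≤ 2 * C + 2 * C' := by linarith [(hC t ht).2, (hC' t ht).2]

end IsSecondOrder

section Brownian

variable {Ω : Type*} {mΩ : MeasurableSpace Ω} {P : Measure Ω}
  {F : MeasureTheory.Filtration ℝ mΩ} {B : ℝ → Ω → ℝ}

namespace IsStdBrownian

lemma measurable (hB : IsStdBrownian P F B) (t : ℝ) : Measurable (B t) :=
  (hB.1 t).mono (F.le t) le_rfl

lemma memLp_increment (hB : IsStdBrownian P F B) {s t : ℝ} (hs : 0 ≤ s) (hst : s ≤ t) :
    MemLp (fun ω => B t ω - B s ω) 2 P := by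
  have hm : Measurable fun ω => B t ω - B s ω := (hB.measurable t).sub (hB.measurable s)
  have h1 := memLp_id_gaussianReal (μ := 0) (v := (t - s).toNNReal) 2
  rw [← hB.2.2.2.1 s t hs hst] at h1
  exact (memLp_map_measure_iff aestronglyMeasurable_id hm.aemeasurable).1 h1

lemma integral_increment (hB : IsStdBrownian P F B) {s t : ℝ} (hs : 0 ≤ s) (hst : s ≤ t) :
    ∫ ω, (B t ω - B s ω) ∂P = 0 := by
  have hm : Measurable fun ω => B t ω - B s ω := (hB.measurable t).sub (hB.measurable s)
  have h1 := integral_map (f := fun x : ℝ => x) hm.aemeasurable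
    measurable_id.aestronglyMeasurable (μ := P)
  rw [← h1, hB.2.2.2.1 s t hs hst, integral_id_gaussianReal]

lemma integral_increment_sq (hB : IsStdBrownian P F B) {s t : ℝ} (hs : 0 ≤ s) (hst : s ≤ t) :
    ∫ ω, (B t ω - B s ω) ^ 2 ∂P = t - s := by
  have hm : Measurable fun ω => B t ω - B s ω := (hB.measurable t).sub (hB.measurable s)
  have h1 := integral_map (f := fun x : ℝ => x ^ 2) hm.aemeasurable
    (measurable_id.pow_const 2).aestronglyMeasurable (μ := P)
  have h2 := variance_id_gaussianReal (μ := 0) (v := (t - s).toNNReal)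
  rw [variance_eq_integral measurable_id.aemeasurable] at h2
  simp only [id, integral_id_gaussianReal, sub_zero] at h2
  rw [← h1, hB.2.2.2.1 s t hs hst, h2, Real.coe_toNNReal _ (by linarith)]

lemma memLp (hB : IsStdBrownian P F B) {t : ℝ} (ht : 0 ≤ t) : MemLp (B t) 2 P := by
  simpa [hB.2.1] using hB.memLp_increment le_rfl ht

lemma integral_eq_zero (hB : IsStdBrownian P F B) {t : ℝ} (ht : 0 ≤ t) : ∫ ω, B t ω ∂P = 0 := by
  simpa [hB.2.1] using hB.integral_increment le_rfl ht

lemma integral_sq (hB : IsStdBrownian P F B) {t : ℝ} (ht : 0 ≤ t) : ∫ ω, B t ω ^ 2 ∂P = t := by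
  simpa [hB.2.1] using hB.integral_increment_sq le_rfl ht

lemma integral_mul (hB : IsStdBrownian P F B) {s t : ℝ} (hs : 0 ≤ s) (ht : 0 ≤ t) :
    ∫ ω, B s ω * B t ω ∂P = min s t := by
  wlog hst : s ≤ t generalizing s t
  · rw [min_comm, ← this ht hs (le_of_not_ge hst)]
    simp only [mul_comm]
  have h1 := (hB.memLp hs).integrable_sq
  have h2 := (hB.memLp ht).integrable_sq
  have h3 := (hB.memLp_increment hs hst).integrable_sq
  have e : ∀ ω, B s ω * B t ω = (B s ω ^ 2 + B t ω ^ 2 - (B t ω - B s ω) ^ 2) * (1 / 2) :=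
    fun ω => by ring
  simp_rw [e]
  have h12 : Integrable (fun ω => B s ω ^ 2 + B t ω ^ 2) P := h1.add h2
  rw [integral_mul_const, integral_sub h12 h3, integral_add h1 h2, hB.integral_sq hs,
    hB.integral_sq ht, hB.integral_increment_sq hs hst, min_eq_left hst]
  ring

lemma isSecondOrder (hB : IsStdBrownian P F B) : IsSecondOrder P B :=
  ⟨hB.measurable, hB.2.2.1, fun T => ⟨T, fun _ ht =>
    ⟨hB.memLp ht.1, (hB.integral_sq ht.1).trans_le ht.2⟩⟩⟩

end IsStdBrownian

end Brownian

/-- The Wiener integral `∫_0^t Y dB`, written by parts. -/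
def wienerInt {Ω : Type*} (Y Y' : ℝ → ℝ) (B : ℝ → Ω → ℝ) (t : ℝ) (ω : Ω) : ℝ :=
  Y t * B t ω - ∫ u in (0:ℝ)..t, Y' u * B u ω

namespace IsDecayingSolution

variable {α W : ℝ} {Y Y' : ℝ → ℝ}

lemma integral_by_parts (h : IsDecayingSolution α W Y Y') {g : ℝ → ℝ} (hg : Continuous g)
    {T : ℝ} (hT : 0 ≤ T) :
    Y T * (∫ x in (0:ℝ)..T, g x) - ∫ u in (0:ℝ)..T, Y' u * ∫ x in (0:ℝ)..u, g x
      = ∫ u in (0:ℝ)..T, Y u * g u := by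
  have hGd : ∀ t, HasDerivAt (fun t => ∫ x in (0:ℝ)..t, g x) (g t) t := fun t =>
    (hg.integral_hasStrictDerivAt 0 t).hasDerivAt
  have hGc : Continuous fun t => ∫ x in (0:ℝ)..t, g x :=
    continuous_iff_continuousAt.2 fun t => (hGd t).continuousAt
  have h1 := intervalIntegral.integral_eq_sub_of_hasDerivAt_of_le hT
    (h.cont.mul hGc).continuousOn (fun t ht => (h.deriv t ht.1).mul (hGd t))
    (((h.cont'.mul hGc).add (h.cont.mul hg)).intervalIntegrable _ _)
  have h2 : ∫ t in (0:ℝ)..T, (Y' t * (∫ x in (0:ℝ)..t, g x) + Y t * g t)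
      = (∫ u in (0:ℝ)..T, Y' u * ∫ x in (0:ℝ)..u, g x) + ∫ u in (0:ℝ)..T, Y u * g u :=
    intervalIntegral.integral_add ((h.cont'.mul hGc).intervalIntegrable _ _)
      ((h.cont.mul hg).intervalIntegrable _ _)
  simp only [Pi.mul_apply, intervalIntegral.integral_same, mul_zero, sub_zero] at h1
  linarith

lemma integral_by_parts_min (h : IsDecayingSolution α W Y Y') {g : ℝ → ℝ} (hg : Continuous g)
    {s t : ℝ} (hs : 0 ≤ s) (ht : 0 ≤ t) :
    Y s * (∫ x in (0:ℝ)..min s t, g x) - ∫ u in (0:ℝ)..s, Y' u * ∫ x in (0:ℝ)..min u t, g x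
      = ∫ u in (0:ℝ)..min s t, Y u * g u := by
  have hGc : Continuous fun t => ∫ x in (0:ℝ)..t, g x :=
    intervalIntegral.continuous_primitive (fun a b => hg.intervalIntegrable a b) 0
  have hc : Continuous fun u => Y' u * ∫ x in (0:ℝ)..min u t, g x :=
    h.cont'.mul (hGc.comp (continuous_id.min continuous_const))
  have hlow : ∀ r, 0 ≤ r → r ≤ t → ∫ u in (0:ℝ)..r, Y' u * ∫ x in (0:ℝ)..min u t, g x
      = ∫ u in (0:ℝ)..r, Y' u * ∫ x in (0:ℝ)..u, g x := by
    intro r hr hrt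
    refine intervalIntegral.integral_congr fun u hu => ?_
    rw [uIcc_of_le hr] at hu
    simp only [min_eq_left (hu.2.trans hrt)]
  rcases le_total s t with hst | hst
  · rw [min_eq_left hst, hlow s hs hst, h.integral_by_parts hg hs]
  · have hhigh : ∫ u in t..s, Y' u * ∫ x in (0:ℝ)..min u t, g x
        = (Y s - Y t) * ∫ x in (0:ℝ)..t, g x := by
      rw [← intervalIntegral.integral_eq_sub_of_hasDerivAt_of_le hst h.cont.continuousOn
        (fun u hu => h.deriv u (ht.trans_lt hu.1)) (h.cont'.intervalIntegrable _ _),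
        ← intervalIntegral.integral_mul_const]
      refine intervalIntegral.integral_congr fun u hu => ?_
      rw [uIcc_of_le hst] at hu
      simp only [min_eq_right hu.1]
    rw [min_eq_right hst, ← intervalIntegral.integral_add_adjacent_intervals
      (hc.intervalIntegrable 0 t) (hc.intervalIntegrable t s), hlow t ht le_rfl, hhigh,
      ← h.integral_by_parts hg ht]
    ring

variable {Ω : Type*} {mΩ : MeasurableSpace Ω} {P : Measure Ω} [IsProbabilityMeasure P]
  {F : MeasureTheory.Filtration ℝ mΩ} {A B : ℝ → Ω → ℝ} {U : Ω → ℝ}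

lemma isSecondOrder_wienerInt (h : IsDecayingSolution α W Y Y') (hB : IsSecondOrder P B) :
    IsSecondOrder P (wienerInt Y Y' B) :=
  (hB.smul h.cont).sub (hB.smul h.cont').primitive

lemma integral_mul_wienerInt (h : IsDecayingSolution α W Y Y') (hB : IsSecondOrder P B)
    (hUm : Measurable U) (hU : MemLp U 2 P) {t : ℝ} (ht : 0 ≤ t) :
    ∫ ω, U ω * wienerInt Y Y' B t ω ∂P
      = Y t * (∫ ω, U ω * B t ω ∂P) - ∫ u in (0:ℝ)..t, Y' u * ∫ ω, U ω * B u ω ∂P := by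
  have h1 : Integrable (fun ω => U ω * (Y t * B t ω)) P :=
    hU.integrable_mul ((hB.smul h.cont).memLp ht)
  have h2 : Integrable (fun ω => U ω * ∫ u in (0:ℝ)..t, Y' u * B u ω) P :=
    hU.integrable_mul ((hB.smul h.cont').primitive.memLp ht)
  unfold wienerInt
  simp_rw [mul_sub]
  rw [integral_sub h1 h2, (hB.smul h.cont').integral_mul_primitive hUm hU ht,
    ← integral_const_mul]
  congr 1
  · refine integral_congr_ae (Eventually.of_forall fun ω => ?_)
    ring
  · refine intervalIntegral.integral_congr fun u _ => ?_
    rw [← integral_const_mul]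
    refine integral_congr_ae (Eventually.of_forall fun ω => ?_)
    ring

lemma integral_wienerInt (h : IsDecayingSolution α W Y Y') (hB : IsStdBrownian P F B)
    {t : ℝ} (ht : 0 ≤ t) : ∫ ω, wienerInt Y Y' B t ω ∂P = 0 := by
  have h1 := h.integral_mul_wienerInt hB.isSecondOrder (U := fun _ => 1) measurable_const
    (memLp_const 1) ht
  simp only [one_mul] at h1
  rw [h1, hB.integral_eq_zero ht, intervalIntegral.integral_congr (g := fun _ => 0) fun u hu => ?_]
  · simp
  · rw [uIcc_of_le ht] at hu
    simp [hB.integral_eq_zero hu.1]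

lemma integral_mul_wienerInt_brownian (h : IsDecayingSolution α W Y Y')
    (hB : IsStdBrownian P F B) {s t : ℝ} (hs : 0 ≤ s) (ht : 0 ≤ t) :
    ∫ ω, B t ω * wienerInt Y Y' B s ω ∂P = ∫ u in (0:ℝ)..min s t, Y u := by
  have h1 := h.integral_by_parts_min (g := fun _ => 1) continuous_const hs ht
  simp only [intervalIntegral.integral_const, sub_zero, smul_eq_mul, mul_one] at h1
  rw [h.integral_mul_wienerInt hB.isSecondOrder (hB.measurable t) (hB.memLp ht) hs, ← h1,
    hB.integral_mul ht hs, min_comm]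
  congr 1
  refine intervalIntegral.integral_congr fun u hu => ?_
  rw [uIcc_of_le hs] at hu
  rw [hB.integral_mul ht hu.1, min_comm]

/-- The Itô isometry for `wienerInt`. -/
lemma integral_wienerInt_mul_wienerInt (h : IsDecayingSolution α W Y Y')
    (hB : IsStdBrownian P F B) {s t : ℝ} (hs : 0 ≤ s) (ht : 0 ≤ t) :
    ∫ ω, wienerInt Y Y' B t ω * wienerInt Y Y' B s ω ∂P = ∫ u in (0:ℝ)..min s t, Y u ^ 2 := by
  have hn := h.isSecondOrder_wienerInt hB.isSecondOrder
  have h1 := h.integral_by_parts_min h.cont hs ht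
  simp only [← sq] at h1
  rw [h.integral_mul_wienerInt hB.isSecondOrder (hn.meas t) (hn.memLp ht) hs, ← h1]
  have e : ∀ u, 0 ≤ u → ∫ ω, wienerInt Y Y' B t ω * B u ω ∂P
      = ∫ x in (0:ℝ)..min u t, Y x := by
    intro u hu
    rw [min_comm, ← h.integral_mul_wienerInt_brownian hB ht hu]
    simp only [mul_comm]
  rw [e s hs]
  congr 1
  refine intervalIntegral.integral_congr fun u hu => ?_
  rw [uIcc_of_le hs] at hu
  rw [e u hu.1]

lemma measurable_memoryRate (h : IsDecayingSolution α W Y Y') (hA : IsSecondOrder P A) (t : ℝ) :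
    Measurable fun ω => memoryRate α Y Y' (fun u => A u ω) t := by
  have hm := (hA.smul h.continuous_memoryWeight).primitive.meas t
  have hm' := hA.meas t
  unfold memoryRate memoryInt
  exact (hm'.div_const _).sub ((hm.const_mul _).const_mul _)

lemma memLp_memoryRate (h : IsDecayingSolution α W Y Y') (hA : IsSecondOrder P A) {t : ℝ}
    (ht : 0 ≤ t) : MemLp (fun ω => memoryRate α Y Y' (fun u => A u ω) t) 2 P := by
  have h1 := ((hA.smul h.continuous_memoryWeight).primitive.memLp ht).const_mul
    (relaxRate α Y Y' t * decayFactor α Y t)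
  refine (((hA.memLp ht).const_mul (Y t)⁻¹).sub h1).congr_norm
    (h.measurable_memoryRate hA t).aestronglyMeasurable (Eventually.of_forall fun ω => ?_)
  congr 1
  simp only [memoryRate, memoryInt, Pi.sub_apply]
  ring

lemma integral_mul_memoryRate (h : IsDecayingSolution α W Y Y') (hA : IsSecondOrder P A)
    (hUm : Measurable U) (hU : MemLp U 2 P) {t : ℝ} (ht : 0 ≤ t) :
    ∫ ω, U ω * memoryRate α Y Y' (fun u => A u ω) t ∂P
      = memoryRate α Y Y' (fun u => ∫ ω, U ω * A u ω ∂P) t := by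
  have hw := hA.smul h.continuous_memoryWeight
  have h1 : Integrable (fun ω => U ω * A t ω) P := hU.integrable_mul (hA.memLp ht)
  have h2 : Integrable (fun ω => U ω * ∫ u in (0:ℝ)..t, memoryWeight α Y u * A u ω) P :=
    hU.integrable_mul (hw.primitive.memLp ht)
  have e : ∀ ω, U ω * memoryRate α Y Y' (fun u => A u ω) t
      = (Y t)⁻¹ * (U ω * A t ω) - relaxRate α Y Y' t * decayFactor α Y t *
        (U ω * ∫ u in (0:ℝ)..t, memoryWeight α Y u * A u ω) := by
    intro ω
    simp only [memoryRate, memoryInt]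
    ring
  simp_rw [e]
  rw [integral_sub (h1.const_mul _) (h2.const_mul _), integral_const_mul, integral_const_mul,
    hw.integral_mul_primitive hUm hU ht]
  simp only [memoryRate, memoryInt]
  have e2 : ∀ u, ∫ ω, U ω * (memoryWeight α Y u * A u ω) ∂P
      = memoryWeight α Y u * ∫ ω, U ω * A u ω ∂P := by
    intro u
    rw [← integral_const_mul]
    refine integral_congr_ae (Eventually.of_forall fun ω => ?_)
    ring
  simp_rw [e2]
  ring

end IsDecayingSolution

namespace IsDecayingSolution

variable {α W : ℝ} {Y Y' : ℝ → ℝ}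

lemma memoryRate_congr {G H : ℝ → ℝ} {t : ℝ} (ht : 0 ≤ t) (hGH : ∀ u ∈ Icc 0 t, G u = H u) :
    memoryRate α Y Y' G t = memoryRate α Y Y' H t := by
  have e : ∫ u in (0:ℝ)..t, memoryWeight α Y u * G u
      = ∫ u in (0:ℝ)..t, memoryWeight α Y u * H u := by
    refine intervalIntegral.integral_congr fun u hu => ?_
    rw [uIcc_of_le ht] at hu
    simp only [hGH u hu]
  simp only [memoryRate, memoryInt, e, hGH t ⟨ht, le_rfl⟩]

lemma memoryRate_zero (t : ℝ) : memoryRate α Y Y' (fun _ => 0) t = 0 := by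
  simp [memoryRate, memoryInt]

lemma memoryRate_const_add_mul (h : IsDecayingSolution α W Y Y') {G : ℝ → ℝ}
    (hG : Continuous G) (k σ t : ℝ) :
    memoryRate α Y Y' (fun u => k + σ * G u) t
      = k * memoryRate α Y Y' (fun _ => 1) t + σ * memoryRate α Y Y' G t := by
  have hw := h.continuous_memoryWeight
  have e : ∫ u in (0:ℝ)..t, memoryWeight α Y u * (k + σ * G u)
      = k * (∫ u in (0:ℝ)..t, memoryWeight α Y u * 1)
        + σ * ∫ u in (0:ℝ)..t, memoryWeight α Y u * G u := by
    rw [← intervalIntegral.integral_const_mul, ← intervalIntegral.integral_const_mul,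
      ← intervalIntegral.integral_add (Continuous.intervalIntegrable (by fun_prop) _ _)
        (Continuous.intervalIntegrable (by fun_prop) _ _)]
    refine intervalIntegral.integral_congr fun u _ => ?_
    ring
  simp only [memoryRate, memoryInt, e]
  ring

/-- The transformed path `(α Y - Y') i + Y x` is a Wiener integral, where `i' = x` and `x` solves
the path equation. -/
lemma transformed_path_eq (h : IsDecayingSolution α W Y Y') {x β : ℝ → ℝ} {x₀ Ψ σ : ℝ}
    (hx : Continuous x) (hβ : Continuous β) (hβ0 : β 0 = 0)
    (heq : ∀ t, 0 ≤ t → x t = x₀ + (∫ s in (0:ℝ)..t,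
      (-α * x s + α / 2 / (1 + s) * (Ψ + ∫ u in (0:ℝ)..s, x u))) + σ * β t)
    {t : ℝ} (ht : 0 ≤ t) :
    (α * Y t - Y' t) * (Ψ + ∫ u in (0:ℝ)..t, x u) + Y t * x t
      = (α * Y 0 - Y' 0) * Ψ + Y 0 * x₀
        + σ * (Y t * β t - ∫ u in (0:ℝ)..t, Y' u * β u) := by
  have hid : ∀ s, HasDerivAt (fun s => Ψ + ∫ u in (0:ℝ)..s, x u) (x s) s := fun s =>
    ((hx.integral_hasStrictDerivAt 0 s).hasDerivAt).const_add Ψ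
  have hic : Continuous fun s => Ψ + ∫ u in (0:ℝ)..s, x u :=
    continuous_iff_continuousAt.2 fun s => (hid s).continuousAt
  have hfc : Continuous fun s : ℝ =>
      -α * x s + α / 2 / (1 + max s 0) * (Ψ + ∫ u in (0:ℝ)..s, x u) := by
    have h1 : Continuous fun s : ℝ => α / 2 / (1 + max s 0) :=
      Continuous.div (by fun_prop) (by fun_prop) fun s => by positivity
    exact (hx.const_mul _).add (h1.mul hic)
  have hξd : ∀ s, HasDerivAt (fun s => x₀ + ∫ r in (0:ℝ)..s,
      (-α * x r + α / 2 / (1 + max r 0) * (Ψ + ∫ u in (0:ℝ)..r, x u)))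
      (-α * x s + α / 2 / (1 + max s 0) * (Ψ + ∫ u in (0:ℝ)..s, x u)) s := fun s =>
    ((hfc.integral_hasStrictDerivAt 0 s).hasDerivAt).const_add x₀
  have hξ : ∀ s, 0 ≤ s → x₀ + (∫ r in (0:ℝ)..s,
      (-α * x r + α / 2 / (1 + max r 0) * (Ψ + ∫ u in (0:ℝ)..r, x u))) = x s - σ * β s := by
    intro s hs
    rw [heq s hs, add_sub_cancel_right]
    congr 1
    refine intervalIntegral.integral_congr fun r hr => ?_
    rw [uIcc_of_le hs] at hr
    simp only [max_eq_left hr.1]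
  generalize hi' : (fun s => Ψ + ∫ u in (0:ℝ)..s, x u) = i at *
  generalize hξ' : (fun s => x₀ + ∫ r in (0:ℝ)..s,
      (-α * x r + α / 2 / (1 + max r 0) * (Ψ + ∫ u in (0:ℝ)..r, x u))) = ξ at *
  have hiv : ∀ s, Ψ + ∫ u in (0:ℝ)..s, x u = i s := fun s => congrFun hi' s
  have hξv : ∀ s, 0 ≤ s → ξ s = x s - σ * β s := fun s hs => by rw [← hξ s hs, ← hξ']
  have hξc : Continuous ξ := continuous_iff_continuousAt.2 fun s => (hξd s).continuousAt
  have key := intervalIntegral.integral_eq_sub_of_hasDerivAt_of_le ht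
    (f := fun s => (α * Y s - Y' s) * i s + Y s * ξ s) (f' := fun s => -σ * (Y' s * β s))
    ((((h.cont.const_mul α).sub h.cont').mul hic).add (h.cont.mul hξc)).continuousOn ?_
    (((h.cont'.mul hβ).const_mul _).intervalIntegrable _ _)
  · rw [intervalIntegral.integral_const_mul, hξv t ht, hξv 0 le_rfl, hβ0] at key
    have hi0 : i 0 = Ψ := by rw [← hiv]; simp
    have hx0 : x 0 = x₀ := by rw [heq 0 le_rfl, hβ0]; simp
    rw [hi0, hx0] at key
    rw [hiv]
    linarith
  · intro s hs
    have hs0 : 0 < s := hs.1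
    refine (((((h.deriv s hs0).const_mul α).sub (h.deriv' s hs0)).mul (hid s)).add
      ((h.deriv s hs0).mul (hξd s))).congr_deriv ?_
    rw [hξv s hs0.le, hiv, max_eq_left hs0.le]
    have : 0 < 1 + s := by linarith
    simp only [Pi.sub_apply]
    field_simp
    ring

/-- Explicit solution formula for the path equation with continuous driving path `β`. -/
lemma path_eq (h : IsDecayingSolution α W Y Y') {x β : ℝ → ℝ} {x₀ Ψ σ : ℝ}
    (hx : ContinuousOn x (Ici 0)) (hβ : Continuous β) (hβ0 : β 0 = 0)
    (heq : ∀ t, 0 ≤ t → x t = x₀ + (∫ s in (0:ℝ)..t,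
      (-α * x s + α / 2 / (1 + s) * (Ψ + ∫ u in (0:ℝ)..s, x u))) + σ * β t)
    {t : ℝ} (ht : 0 ≤ t) :
    x t = ((α * Y 0 - Y' 0) * Ψ + Y 0 * x₀) * memoryRate α Y Y' (fun _ => 1) t
        - relaxRate α Y Y' t * decayFactor α Y t * (Ψ / decayFactor α Y 0)
      + σ * memoryRate α Y Y' (fun s => Y s * β s - ∫ u in (0:ℝ)..s, Y' u * β u) t := by
  wlog hxc : Continuous x generalizing x
  · have hmax : ∀ s : ℝ, 0 ≤ s → max s 0 = s := fun s hs => max_eq_left hs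
    have hintg : ∀ s : ℝ, 0 ≤ s → ∫ u in (0:ℝ)..s, x (max u 0) = ∫ u in (0:ℝ)..s, x u := by
      intro s hs
      refine intervalIntegral.integral_congr fun u hu => ?_
      rw [uIcc_of_le hs] at hu
      simp only [hmax u hu.1]
    have hc : Continuous fun s => x (max s 0) :=
      hx.comp_continuous (continuous_id.max continuous_const) fun s => mem_Ici.2 (le_max_right _ _)
    refine (congrArg x (hmax t ht)).symm.trans
      (this (x := fun s => x (max s 0)) hc.continuousOn ?_ hc)
    intro s hs
    simp only [hmax s hs]
    rw [heq s hs]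
    congr 2
    refine intervalIntegral.integral_congr fun u hu => ?_
    rw [uIcc_of_le hs] at hu
    simp only [hmax u hu.1, hintg u hu.1]
  have hnc : Continuous fun s => Y s * β s - ∫ u in (0:ℝ)..s, Y' u * β u :=
    (h.cont.mul hβ).sub (intervalIntegral.continuous_primitive
      (fun a b => (h.cont'.mul hβ).intervalIntegrable a b) 0)
  have hm := fun s (hs : 0 ≤ s) => h.transformed_path_eq hxc hβ hβ0 heq hs
  generalize hk : (α * Y 0 - Y' 0) * Ψ + Y 0 * x₀ = k at *
  generalize hn : (fun s => Y s * β s - ∫ u in (0:ℝ)..s, Y' u * β u) = n at *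
  have hnv : ∀ s, Y s * β s - ∫ u in (0:ℝ)..s, Y' u * β u = n s := fun s => congrFun hn s
  have hid : ∀ s, HasDerivAt (fun s => Ψ + ∫ u in (0:ℝ)..s, x u) (x s) s := fun s =>
    ((hxc.integral_hasStrictDerivAt 0 s).hasDerivAt).const_add Ψ
  have hic : Continuous fun s => Ψ + ∫ u in (0:ℝ)..s, x u :=
    continuous_iff_continuousAt.2 fun s => (hid s).continuousAt
  have hxm : ∀ s, 0 ≤ s → x s = (k + σ * n s) / Y s
      - relaxRate α Y Y' s * (Ψ + ∫ u in (0:ℝ)..s, x u) := by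
    intro s hs
    have h1 := hm s hs
    rw [hnv] at h1
    have hY := h.pos s
    rw [← h1]
    unfold relaxRate
    field_simp
    ring
  have key := intervalIntegral.integral_eq_sub_of_hasDerivAt_of_le ht
    (f := fun s => (Ψ + ∫ u in (0:ℝ)..s, x u) / decayFactor α Y s)
    (f' := fun s => memoryWeight α Y s * (k + σ * n s))
    (hic.div h.continuous_decayFactor fun s => (h.decayFactor_pos s).ne').continuousOn ?_
    ((h.continuous_memoryWeight.mul ((hnc.const_mul σ).const_add k)).intervalIntegrable _ _)
  · rw [intervalIntegral.integral_same, add_zero, eq_sub_iff_add_eq,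
      eq_div_iff (h.decayFactor_pos t).ne'] at key
    rw [sub_add_eq_add_sub, ← h.memoryRate_const_add_mul hnc, hxm t ht, ← key]
    simp only [memoryRate, memoryInt]
    ring
  · intro s hs
    have hv := h.decayFactor_pos s
    have hY := h.pos s
    refine ((hid s).div (h.hasDerivAt_decayFactor hs.1) hv.ne').congr_deriv ?_
    nth_rewrite 1 [hxm s hs.1.le]
    rw [h.memoryWeight_eq]
    field_simp
    ring

variable {Ω : Type*} {mΩ : MeasurableSpace Ω} {P : Measure Ω} [IsProbabilityMeasure P]
  {F : MeasureTheory.Filtration ℝ mΩ} {B : ℝ → Ω → ℝ}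

/-- The covariance of the centred solution with the driving Wiener integral. -/
lemma integral_memoryRate_mul_wienerInt (h : IsDecayingSolution α W Y Y')
    (hB : IsStdBrownian P F B) {t u : ℝ} (ht : 0 ≤ t) (htu : t ≤ u) :
    ∫ ω, memoryRate α Y Y' (fun r => wienerInt Y Y' B r ω) t * wienerInt Y Y' B u ω ∂P
      = memoryRate α Y Y' (fun r => ∫ x in (0:ℝ)..r, Y x ^ 2) t := by
  have hn := h.isSecondOrder_wienerInt hB.isSecondOrder
  have hu := ht.trans htu
  simp_rw [mul_comm _ (wienerInt Y Y' B u _)]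
  rw [h.integral_mul_memoryRate hn (hn.meas u) (hn.memLp hu) ht]
  refine memoryRate_congr ht fun r hr => ?_
  rw [h.integral_wienerInt_mul_wienerInt hB hr.1 hu, min_eq_left (hr.2.trans htu)]

lemma tendsto_integral_memoryRate_mul (h : IsDecayingSolution α W Y Y') (hα : 0 < α)
    (hW : 0 < W) (hB : IsStdBrownian P F B) {t : ℝ} (ht : 0 ≤ t) :
    Tendsto (fun s => √(1 + s) *
      ∫ ω, memoryRate α Y Y' (fun r => wienerInt Y Y' B r ω) t *
        memoryRate α Y Y' (fun r => wienerInt Y Y' B r ω) s ∂P) atTop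
      (nhds (memoryRate α Y Y' (fun r => ∫ x in (0:ℝ)..r, Y x ^ 2) t / (2 * W * α))) := by
  have hn := h.isSecondOrder_wienerInt hB.isSecondOrder
  have hZm := h.measurable_memoryRate hn t
  have hZ := h.memLp_memoryRate hn ht
  have hκ := fun u (hu : t ≤ u) => h.integral_memoryRate_mul_wienerInt hB ht hu
  have hnint : IntervalIntegrable (fun u => memoryWeight α Y u * ∫ ω,
      memoryRate α Y Y' (fun r => wienerInt Y Y' B r ω) t * wienerInt Y Y' B u ω ∂P)
      volume 0 t :=
    (hn.intervalIntegrable_integral_mul hZm hZ ht).continuousOn_mul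
      h.continuous_memoryWeight.continuousOn
  have hE := fun s (hs : 0 ≤ s) => h.integral_mul_memoryRate hn hZm hZ hs
  obtain ⟨K, hK⟩ : ∃ K : ℝ → ℝ, ∀ u, ∫ ω,
      memoryRate α Y Y' (fun r => wienerInt Y Y' B r ω) t * wienerInt Y Y' B u ω ∂P = K u :=
    ⟨_, fun _ => rfl⟩
  simp only [hK] at hκ hnint hE
  generalize memoryRate α Y Y' (fun r => ∫ x in (0:ℝ)..r, Y x ^ 2) t = κ at *
  set C := (∫ u in (0:ℝ)..t, memoryWeight α Y u * K u)
    - κ * ∫ u in (0:ℝ)..t, memoryWeight α Y u * 1 with hC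
  have hlim : Tendsto (fun s => κ * (√(1 + s) * memoryRate α Y Y' (fun _ => 1) s)
      - relaxRate α Y Y' s * (√(1 + s) * decayFactor α Y s) * C) atTop
      (nhds (κ * (1 / (2 * W * α)) - α * 0 * C)) :=
    ((h.tendsto_memoryRate_one hα hW).const_mul κ).sub
      (((h.tendsto_relaxRate hW).mul (h.tendsto_sqrt_mul_decayFactor hα)).mul_const C)
  have e : κ * (1 / (2 * W * α)) - α * 0 * C = κ / (2 * W * α) := by ring
  rw [e] at hlim
  refine hlim.congr' ?_
  filter_upwards [eventually_ge_atTop t] with s hs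
  rw [hE s (ht.trans hs)]
  have hw : Continuous fun u => memoryWeight α Y u * 1 := h.continuous_memoryWeight.mul_const 1
  have htail : ∫ u in t..s, memoryWeight α Y u * K u
      = κ * ∫ u in t..s, memoryWeight α Y u * 1 := by
    rw [← intervalIntegral.integral_const_mul]
    refine intervalIntegral.integral_congr fun u hu => ?_
    rw [uIcc_of_le hs] at hu
    simp only [hκ u hu.1]
    ring
  have htint : IntervalIntegrable (fun u => memoryWeight α Y u * K u) volume t s := by
    refine ((hw.const_mul κ).intervalIntegrable t s).congr fun u hu => ?_
    rw [uIoc_of_le hs] at hu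
    simp only [hκ u hu.1.le]
    ring
  have hsplit : ∫ u in (0:ℝ)..s, memoryWeight α Y u * K u
      = κ * (∫ u in (0:ℝ)..s, memoryWeight α Y u * 1) + C := by
    rw [← intervalIntegral.integral_add_adjacent_intervals hnint htint, htail,
      ← intervalIntegral.integral_add_adjacent_intervals (hw.intervalIntegrable 0 t)
        (hw.intervalIntegrable t s)]
    ring
  simp only [memoryRate, memoryInt, hsplit, hκ s hs]
  ring

lemma integral_memoryRate_wienerInt (h : IsDecayingSolution α W Y Y')
    (hB : IsStdBrownian P F B) {t : ℝ} (ht : 0 ≤ t) :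
    ∫ ω, memoryRate α Y Y' (fun r => wienerInt Y Y' B r ω) t ∂P = 0 := by
  have hn := h.isSecondOrder_wienerInt hB.isSecondOrder
  have h1 := h.integral_mul_memoryRate hn (U := fun _ => 1) measurable_const (memLp_const 1) ht
  simp only [one_mul] at h1
  rw [h1, ← memoryRate_zero (α := α) (Y := Y) (Y' := Y') t]
  exact memoryRate_congr ht fun u hu => h.integral_wienerInt hB hu.1

end IsDecayingSolution

lemma rcov_affine {Ω : Type*} {mΩ : MeasurableSpace Ω} {P : Measure Ω} [IsProbabilityMeasure P]
    {X₁ X₂ Z₁ Z₂ : Ω → ℝ} {d₁ d₂ σ : ℝ} (h₁ : ∀ᵐ ω ∂P, X₁ ω = d₁ + σ * Z₁ ω)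
    (h₂ : ∀ᵐ ω ∂P, X₂ ω = d₂ + σ * Z₂ ω) (hZ₁ : MemLp Z₁ 2 P) (hZ₂ : MemLp Z₂ 2 P)
    (m₁ : ∫ ω, Z₁ ω ∂P = 0) (m₂ : ∫ ω, Z₂ ω ∂P = 0) :
    rcov P X₁ X₂ = σ ^ 2 * ∫ ω, Z₁ ω * Z₂ ω ∂P := by
  have i₁ := hZ₁.integrable one_le_two
  have i₂ := hZ₂.integrable one_le_two
  have i₁₂ : Integrable (fun ω => Z₁ ω * Z₂ ω) P := hZ₁.integrable_mul hZ₂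
  have e₁ : ∫ ω, X₁ ω ∂P = d₁ := by
    rw [integral_congr_ae h₁, integral_add (integrable_const _) (i₁.const_mul σ),
      integral_const_mul, m₁]
    simp
  have e₂ : ∫ ω, X₂ ω ∂P = d₂ := by
    rw [integral_congr_ae h₂, integral_add (integrable_const _) (i₂.const_mul σ),
      integral_const_mul, m₂]
    simp
  have e₁₂ : ∫ ω, X₁ ω * X₂ ω ∂P = d₁ * d₂ + σ ^ 2 * ∫ ω, Z₁ ω * Z₂ ω ∂P := by
    have e : ∀ᵐ ω ∂P, X₁ ω * X₂ ω
        = d₁ * d₂ + d₂ * σ * Z₁ ω + d₁ * σ * Z₂ ω + σ ^ 2 * (Z₁ ω * Z₂ ω) := by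
      filter_upwards [h₁, h₂] with ω a₁ a₂
      rw [a₁, a₂]
      ring
    have j₁ : Integrable (fun ω => d₁ * d₂ + d₂ * σ * Z₁ ω) P :=
      (integrable_const _).add (i₁.const_mul _)
    have j₂ : Integrable (fun ω => d₁ * d₂ + d₂ * σ * Z₁ ω + d₁ * σ * Z₂ ω) P :=
      j₁.add (i₂.const_mul _)
    rw [integral_congr_ae e, integral_add j₂ (i₁₂.const_mul _), integral_add j₁ (i₂.const_mul _),
      integral_add (integrable_const _) (i₁.const_mul _), integral_const_mul, integral_const_mul,
      integral_const_mul, m₁, m₂]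
    simp [integral_const_mul]
  rw [rcov, e₁₂, e₁, e₂]
  ring

lemma tendsto_sqrt_div_sqrt_add (k : ℝ) :
    Tendsto (fun s : ℝ => √s / √(k + s)) atTop (nhds 1) := by
  have h1 : Tendsto (fun s : ℝ => s / (k + s)) atTop (nhds 1) := by
    have h2 : Tendsto (fun s : ℝ => 1 - k / (k + s)) atTop (nhds (1 - 0)) :=
      (tendsto_const_nhds.div_atTop (tendsto_atTop_add_const_left _ k tendsto_id)).const_sub 1
    rw [sub_zero] at h2
    refine h2.congr' ?_
    filter_upwards [eventually_gt_atTop (-k)] with s hs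
    have : k + s ≠ 0 := by linarith
    field_simp
    ring
  have h3 := h1.sqrt
  rw [Real.sqrt_one] at h3
  refine h3.congr' ?_
  filter_upwards [eventually_ge_atTop 0] with s hs
  rw [Real.sqrt_div hs]

lemma tendsto_log_one_add_div_log :
    Tendsto (fun t : ℝ => Real.log (1 + t) / Real.log t) atTop (nhds 1) := by
  refine tendsto_div_of_tendsto_deriv_div (f' := fun t => 1 / (1 + t)) (g' := fun t => t⁻¹)
    ?_ ?_ ?_ Real.tendsto_log_atTop ?_
  · filter_upwards [eventually_gt_atTop 0] with t ht
    exact ((hasDerivAt_id t).const_add 1).log (by simp; linarith)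
  · filter_upwards [eventually_gt_atTop 0] with t ht
    exact Real.hasDerivAt_log ht.ne'
  · filter_upwards [eventually_gt_atTop 0] with t ht
    positivity
  · have h := (tendsto_sqrt_div_sqrt_add 1).pow 2
    rw [one_pow] at h
    refine h.congr' ?_
    filter_upwards [eventually_gt_atTop 0] with t ht
    rw [div_pow, Real.sq_sqrt ht.le, Real.sq_sqrt (by linarith)]
    field_simp

theorem sfde_ct_asymptotics_2b_plus_a_zero {Ω : Type*} {mΩ : MeasurableSpace Ω} (P : Measure Ω) [IsProbabilityMeasure P]
    (F : MeasureTheory.Filtration ℝ mΩ) (a b σ : ℝ) (ψ : ℝ → ℝ) (B X : ℝ → Ω → ℝ)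
    (hσ : 0 < σ) (hψ : ContinuousOn ψ (Set.Icc (-1 : ℝ) 0))
    (hB : IsStdBrownian P F B) (hX : IsSolutionSFDE P F a b σ ψ B X)
    (ha : a < 0) (hb : 0 < b) (h2ba : 2 * b + a = 0) (c : ℝ → ℝ)
    (hc : ∀ t : ℝ, 0 ≤ t → Filter.Tendsto
      (fun Δ : ℝ => Δ ^ (1 + b / a) * rcov P (X t) (X (t + Δ)))
      Filter.atTop (nhds (c t))) :
    Filter.Tendsto (fun t : ℝ => c t / (t ^ (-(1:ℝ)/2) * Real.log t)) Filter.atTop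
      (nhds (σ ^ 2 / (4 * a ^ 2))) ∧
    0 < σ ^ 2 / (4 * a ^ 2) := by
  refine ⟨?_, by have := ha.ne; positivity⟩
  obtain ⟨α, rfl⟩ : ∃ α, a = -α := ⟨-a, by ring⟩
  obtain rfl : b = α / 2 := by linarith
  have hα : 0 < α := by linarith
  obtain ⟨W, hW, Y, Y', h⟩ := exists_isDecayingSolution hα
  have hn := h.isSecondOrder_wienerInt hB.isSecondOrder
  have hexp : 1 + α / 2 / -α = 1 / 2 := by field_simp; norm_num
  rw [hexp] at hc
  obtain ⟨d, hd⟩ : ∃ d : ℝ → ℝ, ∀ t, 0 ≤ t → ∀ᵐ ω ∂P,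
      X t ω = d t + σ * memoryRate α Y Y' (fun r => wienerInt Y Y' B r ω) t := by
    refine ⟨fun t => ((α * Y 0 - Y' 0) * (∫ u in (-1:ℝ)..(0:ℝ), ψ u) + Y 0 * ψ 0)
        * memoryRate α Y Y' (fun _ => 1) t - relaxRate α Y Y' t * decayFactor α Y t
        * ((∫ u in (-1:ℝ)..(0:ℝ), ψ u) / decayFactor α Y 0), fun t ht => ?_⟩
    filter_upwards [hX.2.2] with ω hω
    exact h.path_eq (hX.2.1 ω) (hB.2.2.1 ω) (hB.2.1 ω) hω ht
  have hcov : ∀ t s, 0 ≤ t → 0 ≤ s → rcov P (X t) (X s) = σ ^ 2 *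
      ∫ ω, memoryRate α Y Y' (fun r => wienerInt Y Y' B r ω) t *
        memoryRate α Y Y' (fun r => wienerInt Y Y' B r ω) s ∂P := fun t s ht hs =>
    rcov_affine (hd t ht) (hd s hs) (h.memLp_memoryRate hn ht) (h.memLp_memoryRate hn hs)
      (h.integral_memoryRate_wienerInt hB ht) (h.integral_memoryRate_wienerInt hB hs)
  have hct : ∀ t, 0 ≤ t → c t = σ ^ 2 *
      (memoryRate α Y Y' (fun r => ∫ x in (0:ℝ)..r, Y x ^ 2) t / (2 * W * α)) := by
    intro t ht
    refine tendsto_nhds_unique (hc t ht) ?_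
    have h1 := (h.tendsto_integral_memoryRate_mul hα hW hB ht).comp
      (tendsto_atTop_add_const_left _ t tendsto_id)
    have h2 := ((tendsto_sqrt_div_sqrt_add (1 + t)).mul h1).const_mul (σ ^ 2)
    rw [one_mul] at h2
    refine h2.congr' ?_
    filter_upwards [eventually_ge_atTop 0] with Δ hΔ
    have hs : 0 < √(1 + (t + Δ)) := Real.sqrt_pos.2 (by linarith)
    simp only [Function.comp_apply, id]
    rw [hcov t (t + Δ) ht (by linarith), ← Real.sqrt_eq_rpow, add_assoc]
    field_simp
  have h1 := (((h.tendsto_memoryRate_integral_sq hα hW).mul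
    (tendsto_sqrt_div_sqrt_add 1)).mul tendsto_log_one_add_div_log).const_mul
      (σ ^ 2 / (2 * W * α))
  have e : σ ^ 2 / (2 * W * α) * (W / (2 * α) * 1 * 1) = σ ^ 2 / (4 * (-α) ^ 2) := by
    field_simp
    ring
  rw [e] at h1
  refine h1.congr' ?_
  filter_upwards [eventually_gt_atTop 1] with t ht
  have ht0 : 0 < t := by linarith
  have hs : 0 < √(1 + t) := Real.sqrt_pos.2 (by linarith)
  have hst : 0 < √t := Real.sqrt_pos.2 ht0
  have hl : 0 < Real.log t := Real.log_pos ht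
  have hl1 : 0 < Real.log (1 + t) := Real.log_pos (by linarith)
  have hp : t ^ (-(1:ℝ)/2) = (√t)⁻¹ := by
    rw [Real.sqrt_eq_rpow, ← Real.rpow_neg ht0.le]
    norm_num
  rw [hct t ht0.le, hp]
  field_simp
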